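/- arXiv:2412.19029 — 3 statements merged into one kernel-verified Lean document; each statement's English description precedes it below -/
import Mathlib

section
/- Let (P_t)_{t≥0} be a Markov–Feller semigroup on a Polish space X. Then the following are equivalent: (1) (P_t) is asymptotically stable (with unique invariant probability measure μ); (2) (P_t) is eventually continuous at every point of X and there exists z ∈ X such that for every ε > 0, inf_{x ∈ X} liminf_{t→∞} P_t(x, B(z, ε)) > 0; (3) there exists z ∈ X such that (P_t) is eventually continuous at z and for every ε > 0, inf_{x ∈ X} liminf_{t→∞} P_t(x, B(z, ε)) > 0. -/
open MeasureTheory Filter Metric Set Topology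
open scoped ENNReal

/-- A Markov–Feller semigroup on a metric measurable space `X`: a family of Markov
kernels `P t` (for `t ≥ 0`) such that `P 0` is the identity kernel, the
Chapman–Kolmogorov semigroup property holds, `x ↦ ∫ f d(P t x)` is continuous for
every bounded continuous `f` (Feller property), and `t ↦ ∫ f d(P t x)` is Borel
measurable. -/
structure MarkovFellerSemigroup (X : Type*) [MetricSpace X] [MeasurableSpace X]
    [BorelSpace X] where
  P : ℝ → X → Measure X
  isProb : ∀ t, 0 ≤ t → ∀ x, IsProbabilityMeasure (P t x)
  measurable_x : ∀ t, 0 ≤ t → Measurable (P t)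
  id0 : ∀ x, P 0 x = Measure.dirac x
  semigroup : ∀ s t : ℝ, 0 ≤ s → 0 ≤ t → ∀ x, P (t + s) x = (P t x).bind (P s)
  feller : ∀ (f : BoundedContinuousFunction X ℝ) (t : ℝ), 0 ≤ t →
    Continuous fun x => ∫ y, f y ∂ P t x
  measurable_t : ∀ (f : BoundedContinuousFunction X ℝ) (x : X),
    Measurable fun t : ℝ => ∫ y, f y ∂ P t x

namespace MarkovFellerSemigroup

variable {X : Type*} [MetricSpace X] [MeasurableSpace X] [BorelSpace X]

/-- `P_t f (x) = ∫ f(y) P_t(x, dy)`. -/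
noncomputable def Pf (S : MarkovFellerSemigroup X) (t : ℝ) (f : X → ℝ) (x : X) : ℝ :=
  ∫ y, f y ∂ S.P t x

/-- The Cesàro average `Q_t f (x) = (1/t) ∫_0^t P_s f (x) ds`. -/
noncomputable def Qf (S : MarkovFellerSemigroup X) (t : ℝ) (f : X → ℝ) (x : X) : ℝ :=
  (1 / t) * ∫ s in (0:ℝ)..t, S.Pf s f x

/-- The Cesàro average `Q_t(x, A) = (1/t) ∫_0^t P_s(x, A) ds`. -/
noncomputable def Qmeas (S : MarkovFellerSemigroup X) (t : ℝ) (x : X) (A : Set X) : ℝ :=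
  (1 / t) * ∫ s in (0:ℝ)..t, (S.P s x A).toReal

/-- The action `P_t μ = ∫ P_t(x, ·) μ(dx)` of the semigroup on measures. -/
noncomputable def Pmeas (S : MarkovFellerSemigroup X) (t : ℝ) (μ : Measure X) : Measure X :=
  μ.bind (S.P t)

/-- `⟨f, Q_t μ⟩ = (1/t) ∫_0^t ⟨f, P_s μ⟩ ds`. -/
noncomputable def QfM (S : MarkovFellerSemigroup X) (t : ℝ) (f : X → ℝ) (μ : Measure X) : ℝ :=
  (1 / t) * ∫ s in (0:ℝ)..t, ∫ x, S.Pf s f x ∂μ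

/-- The set `T` of points `x` for which the family `{Q_t(x,·)}_{t>0}` is tight. -/
def Tset (S : MarkovFellerSemigroup X) : Set X :=
  {x | ∀ ε > (0:ℝ), ∃ K : Set X, IsCompact K ∧ ∀ t > (0:ℝ), 1 - ε ≤ S.Qmeas t x K}

/-- Bounded Lipschitz real-valued functions, the class `L_b(X)`. -/
def IsBddLipschitz (f : X → ℝ) : Prop :=
  (∃ K, LipschitzWith K f) ∧ ∃ M, ∀ x, |f x| ≤ M

/-- Eventual continuity at `z`: for every bounded Lipschitz `f`,
`limsup_{x → z} limsup_{t → ∞} |P_t f(x) − P_t f(z)| = 0`. -/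
def EvContAt (S : MarkovFellerSemigroup X) (z : X) : Prop :=
  ∀ f : X → ℝ, IsBddLipschitz f →
    limsup (fun x => limsup (fun t => |S.Pf t f x - S.Pf t f z|) atTop) (𝓝 z) = 0

/-- Cesàro eventual continuity at `z`: for every bounded Lipschitz `f`,
`limsup_{x → z} limsup_{t → ∞} |Q_t f(x) − Q_t f(z)| = 0`. -/
def CesaroEvContAt (S : MarkovFellerSemigroup X) (z : X) : Prop :=
  ∀ f : X → ℝ, IsBddLipschitz f →
    limsup (fun x => limsup (fun t => |S.Qf t f x - S.Qf t f z|) atTop) (𝓝 z) = 0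

/-- An invariant probability measure of the semigroup. -/
def Invariant (S : MarkovFellerSemigroup X) (μ : Measure X) : Prop :=
  IsProbabilityMeasure μ ∧ ∀ t, 0 ≤ t → S.Pmeas t μ = μ

/-- An ergodic invariant probability measure: an invariant probability measure `μ`
such that whenever `μ = (1/2)(μ₁ + μ₂)` with `μ₁, μ₂` invariant probability
measures, `μ₁ = μ₂ = μ`. -/
def ErgodicInv (S : MarkovFellerSemigroup X) (μ : Measure X) : Prop :=
  S.Invariant μ ∧ ∀ μ₁ μ₂ : Measure X, S.Invariant μ₁ → S.Invariant μ₂ →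
    μ = (2 : ℝ≥0∞)⁻¹ • (μ₁ + μ₂) → μ₁ = μ ∧ μ₂ = μ

/-- The support of a measure: points all of whose balls have positive measure. -/
def msupp (μ : Measure X) : Set X :=
  {x | ∀ ε > (0:ℝ), 0 < μ (ball x ε)}

/-- `Q_t(x,·)` converges weakly to `μ` as `t → ∞`. -/
def QWeakLim (S : MarkovFellerSemigroup X) (x : X) (μ : Measure X) : Prop :=
  ∀ f : BoundedContinuousFunction X ℝ,
    Tendsto (fun t => S.Qf t f x) atTop (𝓝 (∫ y, f y ∂μ))

/-- `Q_t ν` converges weakly to `μ` as `t → ∞`. -/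
def QWeakLimM (S : MarkovFellerSemigroup X) (ν : Measure X) (μ : Measure X) : Prop :=
  ∀ f : BoundedContinuousFunction X ℝ,
    Tendsto (fun t => S.QfM t f ν) atTop (𝓝 (∫ y, f y ∂μ))

end MarkovFellerSemigroup

namespace MarkovFellerSemigroup

variable {X : Type*} [MetricSpace X] [CompleteSpace X]
  [TopologicalSpace.SeparableSpace X] [MeasurableSpace X] [BorelSpace X]

/-- Asymptotic stability: there is a unique invariant probability measure `μ*`
and `P_t μ` converges weakly to `μ*` for every probability measure `μ`. -/
def AsympStable (S : MarkovFellerSemigroup X) : Prop :=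
  ∃ μs : Measure X, S.Invariant μs ∧ (∀ ν : Measure X, S.Invariant ν → ν = μs) ∧
    ∀ μ : Measure X, IsProbabilityMeasure μ →
      ∀ f : BoundedContinuousFunction X ℝ,
        Tendsto (fun t => ∫ x, S.Pf t f x ∂μ) atTop (𝓝 (∫ y, f y ∂μs))

set_option linter.unusedSectionVars false

/-- The kernel attached to a nonnegative time. -/
noncomputable def kern (S : MarkovFellerSemigroup X) (t : ℝ) (ht : 0 ≤ t) :
    ProbabilityTheory.Kernel X X := ⟨S.P t, S.measurable_x t ht⟩

theorem kern_markov (S : MarkovFellerSemigroup X) (t : ℝ) (ht : 0 ≤ t) :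
    ProbabilityTheory.IsMarkovKernel (S.kern t ht) := ⟨fun x => S.isProb t ht x⟩

theorem integrable_bdd {μ : Measure X} [IsFiniteMeasure μ] {f : X → ℝ} (hf : Measurable f)
    {M : ℝ} (hM : ∀ x, |f x| ≤ M) : Integrable f μ :=
  Integrable.of_bound hf.aestronglyMeasurable M (Eventually.of_forall hM)

theorem abs_integral_bdd {μ : Measure X} [IsProbabilityMeasure μ] {f : X → ℝ}
    {M : ℝ} (hM : ∀ x, |f x| ≤ M) : |∫ x, f x ∂μ| ≤ M := by
  have := norm_integral_le_of_norm_le_const (μ := μ) (f := f) (C := M) (Eventually.of_forall hM)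
  simpa using this

theorem Pf_bound (S : MarkovFellerSemigroup X) {t : ℝ} (ht : 0 ≤ t) {f : X → ℝ}
    {M : ℝ} (hM : ∀ x, |f x| ≤ M) (x : X) : |S.Pf t f x| ≤ M := by
  have := S.isProb t ht x
  exact abs_integral_bdd hM

theorem Pf_measurable (S : MarkovFellerSemigroup X) {t : ℝ} (ht : 0 ≤ t) {f : X → ℝ}
    (hf : Measurable f) : Measurable (S.Pf t f) := by
  have := S.kern_markov t ht
  have h : StronglyMeasurable (fun x => ∫ y, f y ∂ (S.kern t ht x)) :=
    hf.stronglyMeasurable.integral_kernel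
  exact h.measurable

theorem Pmeas_prob (S : MarkovFellerSemigroup X) {t : ℝ} (ht : 0 ≤ t) (μ : Measure X)
    [IsProbabilityMeasure μ] : IsProbabilityMeasure (S.Pmeas t μ) := by
  have := S.kern_markov t ht
  have h : IsProbabilityMeasure (μ.bind (S.kern t ht)) := inferInstance
  exact h

theorem integral_Pmeas (S : MarkovFellerSemigroup X) {t : ℝ} (ht : 0 ≤ t) (μ : Measure X)
    [IsProbabilityMeasure μ] {f : X → ℝ} (hf : Measurable f) {M : ℝ} (hM : ∀ x, |f x| ≤ M) :
    ∫ x, f x ∂(S.Pmeas t μ) = ∫ x, S.Pf t f x ∂μ := by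
  have := S.kern_markov t ht
  have := S.Pmeas_prob ht μ
  have hi : Integrable f (μ.bind (S.kern t ht)) :=
    integrable_bdd (μ := S.Pmeas t μ) hf hM
  have h := ProbabilityTheory.Kernel.integral_comp (κ := ProbabilityTheory.Kernel.const Unit μ)
    (η := S.kern t ht) (a := ()) (f := f)
    (by rw [ProbabilityTheory.Kernel.comp_apply]; exact hi)
  rw [ProbabilityTheory.Kernel.comp_apply] at h
  exact h

theorem integral_Pf_add (S : MarkovFellerSemigroup X) {s t : ℝ} (hs : 0 ≤ s) (ht : 0 ≤ t)
    (μ : Measure X) [IsProbabilityMeasure μ] {f : X → ℝ} (hf : Measurable f)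
    {M : ℝ} (hM : ∀ x, |f x| ≤ M) :
    ∫ x, S.Pf (t + s) f x ∂μ = ∫ x, S.Pf s f x ∂(S.Pmeas t μ) := by
  rw [S.integral_Pmeas ht μ (S.Pf_measurable hs hf) (S.Pf_bound hs hM)]
  congr 1
  ext x
  have := S.isProb t ht x
  have h := S.integral_Pmeas hs (S.P t x) hf hM
  unfold Pf
  rw [S.semigroup s t hs ht x]
  exact h

theorem Pf_add (S : MarkovFellerSemigroup X) {s t : ℝ} (hs : 0 ≤ s) (ht : 0 ≤ t)
    (x : X) {f : X → ℝ} (hf : Measurable f)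
    {M : ℝ} (hM : ∀ x, |f x| ≤ M) :
    S.Pf (t + s) f x = ∫ y, S.Pf s f y ∂(S.P t x) := by
  have := S.isProb t ht x
  have h := S.integral_Pmeas hs (S.P t x) hf hM
  unfold Pf
  rw [S.semigroup s t hs ht x]
  exact h

theorem real_Pmeas (S : MarkovFellerSemigroup X) {t : ℝ} (ht : 0 ≤ t) (μ : Measure X)
    [IsProbabilityMeasure μ] {B : Set X} (hB : MeasurableSet B) :
    (S.Pmeas t μ).real B = ∫ x, (S.P t x B).toReal ∂μ := by
  have := S.Pmeas_prob ht μ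
  have h := S.integral_Pmeas ht μ (f := B.indicator 1) (measurable_one.indicator hB) (M := 1)
    (fun x => by by_cases hx : x ∈ B <;> simp [hx])
  rw [integral_indicator_one hB] at h
  rw [h]
  congr 1
  ext x
  unfold Pf
  rw [integral_indicator_one hB]
  rfl

theorem measurable_P_toReal (S : MarkovFellerSemigroup X) {t : ℝ} (ht : 0 ≤ t) {B : Set X}
    (hB : MeasurableSet B) : Measurable fun x => (S.P t x B).toReal :=
  ((Measure.measurable_coe hB).comp (S.measurable_x t ht)).ennreal_toReal

theorem P_toReal_le_one (S : MarkovFellerSemigroup X) {t : ℝ} (ht : 0 ≤ t) (x : X) (B : Set X) :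
    (S.P t x B).toReal ≤ 1 := by
  have := S.isProb t ht x
  exact measureReal_le_one (μ := S.P t x) (s := B)

/-- A lower bound along every orbit gives a lower bound for every initial law. -/
theorem eventually_lower (S : MarkovFellerSemigroup X) {B : Set X} (hB : MeasurableSet B)
    {c : ℝ} (hc : 0 < c)
    (h : ∀ x, c ≤ liminf (fun t => (S.P t x B).toReal) atTop)
    (μ : Measure X) [IsProbabilityMeasure μ] :
    ∀ᶠ t in atTop, c / 4 ≤ (S.Pmeas t μ).real B := by
  have hpt : ∀ x, ∀ᶠ t in atTop, c / 2 < (S.P t x B).toReal := fun x =>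
    eventually_lt_of_lt_liminf (lt_of_lt_of_le (by linarith) (h x))
      (isBoundedUnder_of ⟨0, fun t => ENNReal.toReal_nonneg⟩)
  have hlim : Tendsto (fun t => ∫ x, min (S.P t x B).toReal (c / 2) ∂μ) atTop
      (𝓝 (∫ x, c / 2 ∂μ)) := by
    refine tendsto_integral_filter_of_dominated_convergence (fun _ => c / 2) ?_ ?_ ?_ ?_
    · filter_upwards [eventually_ge_atTop 0] with t ht
      exact ((S.measurable_P_toReal ht hB).min measurable_const).aestronglyMeasurable
    · refine Eventually.of_forall fun t => Eventually.of_forall fun x => ?_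
      rw [Real.norm_eq_abs, abs_of_nonneg (le_min ENNReal.toReal_nonneg (by linarith))]
      exact min_le_right _ _
    · exact integrable_const _
    · refine Eventually.of_forall fun x => ?_
      refine tendsto_const_nhds.congr' ?_
      filter_upwards [hpt x] with t ht
      exact (min_eq_right ht.le).symm
  simp only [integral_const, probReal_univ, smul_eq_mul, one_mul] at hlim
  filter_upwards [hlim.eventually (lt_mem_nhds (show c / 4 < c / 2 by linarith)),
    eventually_ge_atTop 0] with t ht ht0
  rw [S.real_Pmeas ht0 μ hB]
  refine ht.le.trans (integral_mono ?_ ?_ fun x => min_le_left _ _)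
  · refine integrable_bdd ((S.measurable_P_toReal ht0 hB).min measurable_const) (M := c / 2) ?_
    intro x
    rw [abs_of_nonneg (le_min ENNReal.toReal_nonneg (by linarith))]
    exact min_le_right _ _
  · refine integrable_bdd (S.measurable_P_toReal ht0 hB) (M := 1) ?_
    intro x
    rw [abs_of_nonneg ENNReal.toReal_nonneg]
    exact S.P_toReal_le_one ht0 x B

/-- Laws carried by a set on which eventual closeness holds. -/
theorem eventually_close (S : MarkovFellerSemigroup X) {B : Set X} {f : X → ℝ}
    (hf : Measurable f) {M : ℝ} (hM : ∀ x, |f x| ≤ M) (z : X) {η : ℝ} (hη : 0 < η)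
    (h : ∀ x ∈ B, ∀ᶠ t in atTop, |S.Pf t f x - S.Pf t f z| ≤ η)
    (ν : Measure X) [IsProbabilityMeasure ν] (hν : ∀ᵐ x ∂ν, x ∈ B) :
    ∀ᶠ t in atTop, |∫ x, S.Pf t f x ∂ν - S.Pf t f z| ≤ 2 * η := by
  have hM0 : 0 ≤ M := (abs_nonneg _).trans (hM z)
  have hb : ∀ t, 0 ≤ t → ∀ x, |S.Pf t f x - S.Pf t f z| ≤ 2 * M := fun t ht x => by
    have h1 := S.Pf_bound ht hM x
    have h2 := S.Pf_bound ht hM z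
    rw [abs_le] at *
    constructor <;> linarith
  have hlim : Tendsto (fun t => ∫ x, max (|S.Pf t f x - S.Pf t f z| - η) 0 ∂ν) atTop
      (𝓝 (∫ x, (0 : ℝ) ∂ν)) := by
    refine tendsto_integral_filter_of_dominated_convergence (fun _ => 2 * M) ?_ ?_ ?_ ?_
    · filter_upwards [eventually_ge_atTop 0] with t ht
      have := S.Pf_measurable ht hf
      exact Measurable.aestronglyMeasurable (by fun_prop)
    · filter_upwards [eventually_ge_atTop 0] with t ht
      refine Eventually.of_forall fun x => ?_
      rw [Real.norm_eq_abs, abs_of_nonneg (le_max_right _ _)]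
      exact max_le (by linarith [hb t ht x]) (by linarith)
    · exact integrable_const _
    · filter_upwards [hν] with x hx
      refine tendsto_const_nhds.congr' ?_
      filter_upwards [h x hx] with t ht
      exact (max_eq_right (by linarith)).symm
  simp only [integral_zero] at hlim
  filter_upwards [hlim.eventually (gt_mem_nhds hη), eventually_ge_atTop 0] with t ht ht0
  have hmeas := S.Pf_measurable ht0 hf
  have hi : Integrable (fun x => S.Pf t f x - S.Pf t f z) ν :=
    integrable_bdd (by fun_prop) (hb t ht0)
  have hi2 : Integrable (fun x => max (|S.Pf t f x - S.Pf t f z| - η) 0) ν :=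
    integrable_bdd (by fun_prop) (M := 2 * M) fun x => by
      rw [abs_of_nonneg (le_max_right _ _)]
      exact max_le (by linarith [hb t ht0 x]) (by linarith)
  calc |∫ x, S.Pf t f x ∂ν - S.Pf t f z|
      = |∫ x, (S.Pf t f x - S.Pf t f z) ∂ν| := by
        rw [integral_sub (integrable_bdd hmeas (S.Pf_bound ht0 hM)) (integrable_const _)]
        simp
    _ ≤ ∫ x, |S.Pf t f x - S.Pf t f z| ∂ν := abs_integral_le_integral_abs
    _ ≤ ∫ x, (max (|S.Pf t f x - S.Pf t f z| - η) 0 + η) ∂ν := by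
        refine integral_mono hi.abs (hi2.add (integrable_const _)) fun x => ?_
        have := le_max_left (|S.Pf t f x - S.Pf t f z| - η) 0
        simp only
        linarith
    _ = ∫ x, max (|S.Pf t f x - S.Pf t f z| - η) 0 ∂ν + η := by
        rw [integral_add hi2 (integrable_const _)]
        simp
    _ ≤ 2 * η := by linarith

/-- Decomposition of a probability measure along a set of positive measure. -/
theorem exists_decomp (m : Measure X) [IsProbabilityMeasure m] {B : Set X}
    (hB : MeasurableSet B) (hpos : 0 < m.real B) :
    ∃ ν ν' : Measure X, IsProbabilityMeasure ν ∧ IsProbabilityMeasure ν' ∧ (∀ᵐ x ∂ν, x ∈ B) ∧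
      ∀ (g : X → ℝ) (M : ℝ), Measurable g → (∀ x, |g x| ≤ M) →
        ∫ x, g x ∂m = m.real B * ∫ x, g x ∂ν + (1 - m.real B) * ∫ x, g x ∂ν' := by
  have hmB : m B ≠ 0 := by
    intro h
    simp [Measure.real, h] at hpos
  have key : ∀ (C : Set X), m C ≠ 0 → ∀ g : X → ℝ,
      ∫ x in C, g x ∂m = m.real C * ∫ x, g x ∂(ProbabilityTheory.cond m C) := by
    intro C hC g
    have hC' : m.real C ≠ 0 := by
      simp [Measure.real, hC, ENNReal.toReal_eq_zero_iff]
    rw [ProbabilityTheory.cond, integral_smul_measure, smul_eq_mul, ENNReal.toReal_inv]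
    change _ = m.real C * ((m.real C)⁻¹ * _)
    rw [← mul_assoc, mul_inv_cancel₀ hC', one_mul]
  have hc : m.real Bᶜ = 1 - m.real B := by
    rw [measureReal_compl hB, probReal_univ]
  have hν : IsProbabilityMeasure (ProbabilityTheory.cond m B) :=
    ProbabilityTheory.cond_isProbabilityMeasure hmB
  by_cases h : m Bᶜ = 0
  · refine ⟨ProbabilityTheory.cond m B, m, hν, inferInstance, ?_, ?_⟩
    · exact ProbabilityTheory.ae_cond_mem hB
    · intro g M hg hM
      have h1 : m.real B = 1 := by
        have : m.real Bᶜ = 0 := by simp [Measure.real, h]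
        linarith
      rw [← integral_add_compl hB (integrable_bdd hg hM), key B hmB g,
        Measure.restrict_eq_zero.2 h, h1]
      simp
  · refine ⟨ProbabilityTheory.cond m B, ProbabilityTheory.cond m Bᶜ, hν,
      ProbabilityTheory.cond_isProbabilityMeasure h, ProbabilityTheory.ae_cond_mem hB, ?_⟩
    intro g M hg hM
    rw [← integral_add_compl hB (integrable_bdd hg hM), key B hmB g, key Bᶜ h g, hc]

theorem evCont_ball (S : MarkovFellerSemigroup X) {z : X} (hE : S.EvContAt z) {f : X → ℝ}
    (hf : IsBddLipschitz f) {η : ℝ} (hη : 0 < η) :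
    ∃ δ > 0, ∀ x ∈ ball z δ, ∀ᶠ t in atTop, |S.Pf t f x - S.Pf t f z| ≤ η := by
  obtain ⟨M, hM⟩ := hf.2
  have hb : ∀ x, ∀ᶠ t in atTop, |S.Pf t f x - S.Pf t f z| ≤ 2 * M := fun x => by
    filter_upwards [eventually_ge_atTop 0] with t ht
    have h1 := S.Pf_bound ht hM x
    have h2 := S.Pf_bound ht hM z
    rw [abs_le] at *
    constructor <;> linarith
  have h0 := hE f hf
  have h1 : ∀ᶠ x in 𝓝 z, limsup (fun t => |S.Pf t f x - S.Pf t f z|) atTop < η := by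
    refine eventually_lt_of_limsup_lt (by rw [h0]; exact hη) ?_
    refine isBoundedUnder_of ⟨2 * M, fun x => ?_⟩
    exact limsup_le_of_le (IsBoundedUnder.isCoboundedUnder_le
      (isBoundedUnder_of ⟨0, fun t => abs_nonneg _⟩)) (hb x)
  obtain ⟨δ, hδ, h2⟩ := Metric.eventually_nhds_iff_ball.1 h1
  refine ⟨δ, hδ, fun x hx => ?_⟩
  exact (eventually_lt_of_limsup_lt (h2 x hx) ⟨2 * M, by simpa using hb x⟩).mono
    fun t ht => ht.le

theorem claimA_step {β₁ β₂ u₁ u₁' u₂ u₂' α e a : ℝ} (hα : 0 < α) (h1 : α ≤ β₁) (h2 : α ≤ β₂)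
    (h1' : β₁ ≤ 1) (h2' : β₂ ≤ 1) (hea : e ≤ a)
    (ha : |u₁ - u₂| ≤ e) (hb : |u₁ - u₂'| ≤ a) (hc : |u₁' - u₂| ≤ a) (hd : |u₁' - u₂'| ≤ a) :
    |(β₁ * u₁ + (1 - β₁) * u₁') - (β₂ * u₂ + (1 - β₂) * u₂')| ≤ e + (1 - α ^ 2) * (a - e) := by
  have e1 : (β₁ * u₁ + (1 - β₁) * u₁') - (β₂ * u₂ + (1 - β₂) * u₂') =
      (β₁ * β₂) * (u₁ - u₂) + (β₁ * (1 - β₂)) * (u₁ - u₂') + ((1 - β₁) * β₂) * (u₁' - u₂)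
        + ((1 - β₁) * (1 - β₂)) * (u₁' - u₂') := by ring
  have p1 : 0 ≤ β₁ * β₂ := by nlinarith
  have p2 : 0 ≤ β₁ * (1 - β₂) := mul_nonneg (by linarith) (by linarith)
  have p3 : 0 ≤ (1 - β₁) * β₂ := mul_nonneg (by linarith) (by linarith)
  have p4 : 0 ≤ (1 - β₁) * (1 - β₂) := mul_nonneg (by linarith) (by linarith)
  have p5 : α ^ 2 ≤ β₁ * β₂ := by nlinarith
  have p6 : 0 ≤ (β₁ * β₂ - α ^ 2) * (a - e) := mul_nonneg (by linarith) (by linarith)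
  rw [abs_le] at *
  rw [e1]
  have q1 := mul_le_mul_of_nonneg_left ha.2 p1
  have q2 := mul_le_mul_of_nonneg_left hb.2 p2
  have q3 := mul_le_mul_of_nonneg_left hc.2 p3
  have q4 := mul_le_mul_of_nonneg_left hd.2 p4
  have r1 := mul_le_mul_of_nonneg_left ha.1 p1
  have r2 := mul_le_mul_of_nonneg_left hb.1 p2
  have r3 := mul_le_mul_of_nonneg_left hc.1 p3
  have r4 := mul_le_mul_of_nonneg_left hd.1 p4
  constructor
  · nlinarith
  · nlinarith

/-- The lower bound property at `z`. -/
def LowerBd (S : MarkovFellerSemigroup X) (z : X) : Prop :=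
  ∀ ε > (0:ℝ), ∃ c > (0:ℝ), ∀ x : X,
          c ≤ liminf (fun t => (S.P t x (ball z ε)).toReal) atTop

theorem claimA (S : MarkovFellerSemigroup X) {z : X} (hE : S.EvContAt z) (hL : S.LowerBd z)
    {f : X → ℝ} (hf : IsBddLipschitz f) (μ ν : Measure X) [IsProbabilityMeasure μ]
    [IsProbabilityMeasure ν] :
    Tendsto (fun t => ∫ x, S.Pf t f x ∂μ - ∫ x, S.Pf t f x ∂ν) atTop (𝓝 0) := by
  obtain ⟨M, hM⟩ := hf.2
  have hM0 : 0 ≤ M := (abs_nonneg _).trans (hM z)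
  have hfm : Measurable f := by
    obtain ⟨K, hK⟩ := hf.1
    exact hK.continuous.measurable
  have main : ∀ η > 0, ∃ α > 0, α ≤ 1 ∧ ∀ n : ℕ, ∀ μ ν : Measure X, IsProbabilityMeasure μ →
      IsProbabilityMeasure ν → ∀ᶠ t in atTop,
        |∫ x, S.Pf t f x ∂μ - ∫ x, S.Pf t f x ∂ν| ≤ 4 * η + (1 - α ^ 2) ^ n * (2 * M) := by
    intro η hη
    obtain ⟨δ, hδ, hball⟩ := S.evCont_ball hE hf hη
    obtain ⟨c, hc, hcl⟩ := hL δ hδ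
    have hα0 : 0 < min (c / 4) 1 := lt_min (by linarith) one_pos
    refine ⟨min (c / 4) 1, hα0, min_le_right _ _, ?_⟩
    set α := min (c / 4) 1
    have hα1 : α ≤ 1 := min_le_right _ _
    intro n
    induction n with
    | zero =>
      intro μ ν hμ hν
      filter_upwards [eventually_ge_atTop 0] with t ht
      have h1 := abs_integral_bdd (μ := μ) (S.Pf_bound ht hM)
      have h2 := abs_integral_bdd (μ := ν) (S.Pf_bound ht hM)
      rw [abs_le] at *
      constructor <;> simp <;> linarith
    | succ n ih =>
      intro μ ν hμ hν
      obtain ⟨T, ⟨hT1, hT2⟩, hT0⟩ := ((S.eventually_lower measurableSet_ball hc hcl μ).and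
        (S.eventually_lower measurableSet_ball hc hcl ν)).and (eventually_ge_atTop 0) |>.exists
      have hm1 := S.Pmeas_prob hT0 μ
      have hm2 := S.Pmeas_prob hT0 ν
      have hb1 : α ≤ (S.Pmeas T μ).real (ball z δ) := (min_le_left _ _).trans hT1
      have hb2 : α ≤ (S.Pmeas T ν).real (ball z δ) := (min_le_left _ _).trans hT2
      obtain ⟨ν₁, ν₁', i1, i1', s1, d1⟩ := exists_decomp (S.Pmeas T μ)
        (measurableSet_ball (x := z) (ε := δ)) (hα0.trans_le hb1)
      obtain ⟨ν₂, ν₂', i2, i2', s2, d2⟩ := exists_decomp (S.Pmeas T ν)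
        (measurableSet_ball (x := z) (ε := δ)) (hα0.trans_le hb2)
      have E : ∀ᶠ t in atTop, |∫ x, S.Pf (T + t) f x ∂μ - ∫ x, S.Pf (T + t) f x ∂ν| ≤
          4 * η + (1 - α ^ 2) ^ (n + 1) * (2 * M) := by
        filter_upwards [S.eventually_close hfm hM z hη hball ν₁ s1,
          S.eventually_close hfm hM z hη hball ν₂ s2, ih ν₁ ν₂' i1 i2', ih ν₁' ν₂ i1' i2,
          ih ν₁' ν₂' i1' i2', eventually_ge_atTop 0] with t c1 c2 k1 k2 k3 ht
        rw [S.integral_Pf_add ht hT0 μ hfm hM, S.integral_Pf_add ht hT0 ν hfm hM,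
          d1 _ M (S.Pf_measurable ht hfm) (S.Pf_bound ht hM),
          d2 _ M (S.Pf_measurable ht hfm) (S.Pf_bound ht hM)]
        have hnn : 0 ≤ (1 - α ^ 2) ^ n * (2 * M) :=
          mul_nonneg (pow_nonneg (by nlinarith) n) (by linarith)
        have c3 : |∫ x, S.Pf t f x ∂ν₁ - ∫ x, S.Pf t f x ∂ν₂| ≤ 4 * η := by
          rw [abs_le] at *
          constructor <;> linarith
        refine (claimA_step hα0 hb1 hb2 measureReal_le_one measureReal_le_one
          (by linarith) c3 k1 k2 k3).trans (le_of_eq ?_)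
        ring
      rw [eventually_atTop] at E ⊢
      obtain ⟨t₀, h0⟩ := E
      refine ⟨T + t₀, fun t ht => ?_⟩
      have := h0 (t - T) (by linarith)
      rwa [show T + (t - T) = t by ring] at this
  rw [Metric.tendsto_nhds]
  intro ε hε
  obtain ⟨α, hα, hα1, h⟩ := main (ε / 16) (by linarith)
  have hp : Tendsto (fun n : ℕ => (1 - α ^ 2) ^ n * (2 * M)) atTop (𝓝 0) := by
    have := (tendsto_pow_atTop_nhds_zero_of_lt_one (r := 1 - α ^ 2) (by nlinarith)
      (by nlinarith)).mul_const (2 * M)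
    simpa using this
  obtain ⟨n, hn⟩ := (hp.eventually (gt_mem_nhds (show 0 < ε / 4 by linarith))).exists
  filter_upwards [h n μ ν inferInstance inferInstance] with t ht
  rw [Real.dist_eq, sub_zero]
  linarith

theorem claimA_pt (S : MarkovFellerSemigroup X) {z : X} (hE : S.EvContAt z) (hL : S.LowerBd z)
    {f : X → ℝ} (hf : IsBddLipschitz f) (x y : X) :
    Tendsto (fun t => S.Pf t f x - S.Pf t f y) atTop (𝓝 0) := by
  have hfm : Measurable f := by
    obtain ⟨K, hK⟩ := hf.1
    exact hK.continuous.measurable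
  refine (S.claimA hE hL hf (Measure.dirac x) (Measure.dirac y)).congr' ?_
  filter_upwards [eventually_ge_atTop 0] with t ht
  rw [integral_dirac' _ _ (S.Pf_measurable ht hfm).stronglyMeasurable,
    integral_dirac' _ _ (S.Pf_measurable ht hfm).stronglyMeasurable]

/-- A Lipschitz bump function around a set. -/
noncomputable def bump (r : ℝ) (hr : 0 < r) (A : Set X) : X → ℝ :=
  fun x => (thickenedIndicator hr A x : ℝ)

theorem bump_nonneg {r : ℝ} (hr : 0 < r) (A : Set X) (x : X) : 0 ≤ bump r hr A x :=
  NNReal.coe_nonneg _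

theorem bump_le_one {r : ℝ} (hr : 0 < r) (A : Set X) (x : X) : bump r hr A x ≤ 1 := by
  exact_mod_cast thickenedIndicator_le_one hr A x

theorem bump_abs {r : ℝ} (hr : 0 < r) (A : Set X) (x : X) : |bump r hr A x| ≤ 1 := by
  rw [abs_of_nonneg (bump_nonneg hr A x)]
  exact bump_le_one hr A x

theorem bump_lip {r : ℝ} (hr : 0 < r) (A : Set X) : IsBddLipschitz (bump r hr A) := by
  exact ⟨⟨r.toNNReal⁻¹, lipschitzWith_thickenedIndicator hr A⟩, 1, bump_abs hr A⟩

theorem bump_cont {r : ℝ} (hr : 0 < r) (A : Set X) : Continuous (bump r hr A) :=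
  (bump_lip hr A).1.choose_spec.continuous

theorem bump_one {r : ℝ} (hr : 0 < r) {A : Set X} {x : X} (hx : x ∈ A) : bump r hr A x = 1 := by
  unfold bump
  rw [thickenedIndicator_one hr A hx]
  rfl

theorem bump_zero {r : ℝ} (hr : 0 < r) {A : Set X} {x : X} (hx : x ∉ thickening r A) :
    bump r hr A x = 0 := by
  unfold bump
  rw [thickenedIndicator_zero hr A hx]
  rfl

theorem bump_mono {r : ℝ} (hr : 0 < r) {A B : Set X} (h : A ⊆ B) (x : X) :
    bump r hr A x ≤ bump r hr B x := by
  exact_mod_cast thickenedIndicator_subset hr h x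

theorem bump_union_le {r : ℝ} (hr : 0 < r) (A B : Set X) (x : X) :
    bump r hr (A ∪ B) x ≤ bump r hr A x + bump r hr B x := by
  have hA := bump_nonneg hr A x
  have hB := bump_nonneg hr B x
  rcases le_total (infEDist x A) (infEDist x B) with h | h
  · have : bump r hr (A ∪ B) x = bump r hr A x := by
      simp [bump, thickenedIndicator_apply, thickenedIndicatorAux, infEDist_union, min_eq_left h]
    linarith
  · have : bump r hr (A ∪ B) x = bump r hr B x := by
      simp [bump, thickenedIndicator_apply, thickenedIndicatorAux, infEDist_union, min_eq_right h]
    linarith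

theorem bump_add_le {r : ℝ} (hr : 0 < r) {A B : Set X}
    (h : Disjoint (thickening r A) (thickening r B)) (x : X) :
    bump r hr A x + bump r hr B x ≤ bump r hr (A ∪ B) x := by
  by_cases hx : x ∈ thickening r A
  · rw [bump_zero hr (Set.disjoint_left.1 h hx), add_zero]
    exact bump_mono hr subset_union_left x
  · rw [bump_zero hr hx, zero_add]
    exact bump_mono hr subset_union_right x

theorem Pf_bump_le (S : MarkovFellerSemigroup X) {t : ℝ} (ht : 0 ≤ t) {r : ℝ} (hr : 0 < r)
    {A V : Set X} (hV : MeasurableSet V) (h : thickening r A ⊆ V) (x : X) :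
    S.Pf t (bump r hr A) x ≤ (S.P t x).real V := by
  have := S.isProb t ht x
  rw [← integral_indicator_one hV]
  refine integral_mono (integrable_bdd (bump_cont hr A).measurable (bump_abs hr A))
    ((integrable_const (1 : ℝ)).indicator hV) fun y => ?_
  by_cases hy : y ∈ V
  · simpa [hy] using bump_le_one hr A y
  · simp [hy, bump_zero hr (fun h' => hy (h h'))]

theorem le_Pf_bump (S : MarkovFellerSemigroup X) {t : ℝ} (ht : 0 ≤ t) {r : ℝ} (hr : 0 < r)
    {A : Set X} (hA : MeasurableSet A) (x : X) :
    (S.P t x).real A ≤ S.Pf t (bump r hr A) x := by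
  have := S.isProb t ht x
  rw [← integral_indicator_one hA]
  refine integral_mono ((integrable_const (1 : ℝ)).indicator hA)
    (integrable_bdd (bump_cont hr A).measurable (bump_abs hr A)) fun y => ?_
  by_cases hy : y ∈ A
  · simp [hy, bump_one hr hy]
  · simpa [hy] using bump_nonneg hr A y

theorem Pf_bump_mono (S : MarkovFellerSemigroup X) {t : ℝ} (ht : 0 ≤ t) {r : ℝ} (hr : 0 < r)
    {A B : Set X} (h : A ⊆ B) (x : X) :
    S.Pf t (bump r hr A) x ≤ S.Pf t (bump r hr B) x := by
  have := S.isProb t ht x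
  exact integral_mono (integrable_bdd (bump_cont hr A).measurable (bump_abs hr A))
    (integrable_bdd (bump_cont hr B).measurable (bump_abs hr B)) (bump_mono hr h)

theorem Pf_bump_union_le (S : MarkovFellerSemigroup X) {t : ℝ} (ht : 0 ≤ t) {r : ℝ} (hr : 0 < r)
    (A B : Set X) (x : X) :
    S.Pf t (bump r hr (A ∪ B)) x ≤ S.Pf t (bump r hr A) x + S.Pf t (bump r hr B) x := by
  have := S.isProb t ht x
  have hi : ∀ A : Set X, Integrable (bump r hr A) (S.P t x) := fun A =>
    integrable_bdd (bump_cont hr A).measurable (bump_abs hr A)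
  unfold Pf
  rw [← integral_add (hi A) (hi B)]
  exact integral_mono (hi _) ((hi A).add (hi B)) (bump_union_le hr A B)

theorem Pf_bump_add_le (S : MarkovFellerSemigroup X) {t : ℝ} (ht : 0 ≤ t) {r : ℝ} (hr : 0 < r)
    {A B : Set X} (h : Disjoint (thickening r A) (thickening r B)) (x : X) :
    S.Pf t (bump r hr A) x + S.Pf t (bump r hr B) x ≤ S.Pf t (bump r hr (A ∪ B)) x := by
  have := S.isProb t ht x
  have hi : ∀ A : Set X, Integrable (bump r hr A) (S.P t x) := fun A =>
    integrable_bdd (bump_cont hr A).measurable (bump_abs hr A)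
  unfold Pf
  rw [← integral_add (hi A) (hi B)]
  exact integral_mono ((hi A).add (hi B)) (hi _) (bump_add_le hr h)

theorem Pf_bump_cont (S : MarkovFellerSemigroup X) {t : ℝ} (ht : 0 ≤ t) {r : ℝ} (hr : 0 < r)
    (A : Set X) : Continuous (S.Pf t (bump r hr A)) :=
  S.feller (BoundedContinuousFunction.ofNormedAddCommGroup (bump r hr A) (bump_cont hr A) 1
    (bump_abs hr A)) t ht

/-- Gliding hump. -/
theorem hump (S : MarkovFellerSemigroup X) {z : X} (hE : S.EvContAt z) (hL : S.LowerBd z)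
    {r : ℝ} (hr : 0 < r) {ε : ℝ} (hε : 0 < ε) (K : ℕ → Set X) (q : ℕ → ℕ)
    (hq : Tendsto q atTop atTop)
    (hdisj : Pairwise (Function.onFun Disjoint fun i => thickening r (K i)))
    (hz : ∀ i, ε ≤ S.Pf (q i) (bump r hr (K i)) z) (x : X) :
    ∀ᶠ i in atTop, ε / 2 ≤ S.Pf (q i) (bump r hr (K i)) x := by
  by_contra hcon
  rw [not_eventually] at hcon
  have hq' : Tendsto (fun i => (q i : ℝ)) atTop atTop := tendsto_natCast_atTop_atTop.comp hq
  have hpast : ∀ m : ℕ, ∀ᶠ i in atTop, ∀ s ∈ (Finset.range (m + 1)).powerset,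
      |S.Pf (q i) (bump r hr (⋃ j ∈ s, K j)) x - S.Pf (q i) (bump r hr (⋃ j ∈ s, K j)) z|
        < ε / 8 := by
    intro m
    rw [Filter.eventually_all_finset]
    intro s _
    have h := (S.claimA_pt hE hL (bump_lip hr (⋃ j ∈ s, K j)) x z).comp hq'
    have h2 := h.abs
    simp only [Function.comp_def, abs_zero] at h2
    exact h2.eventually (gt_mem_nhds (by linarith))
  have htail : ∀ m : ℕ, ∀ᶠ i in atTop,
      (S.P (q m) x).real (⋃ j ≥ i, thickening r (K j)) < ε / 8 := by
    intro m
    have := S.isProb (q m) (Nat.cast_nonneg _) x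
    have h := tendsto_measure_biUnion_Ici_zero_of_pairwise_disjoint (μ := S.P (q m) x)
      (Es := fun i => thickening r (K i))
      (fun i => isOpen_thickening.measurableSet.nullMeasurableSet) hdisj
    have h2 := (ENNReal.tendsto_toReal ENNReal.zero_ne_top).comp h
    simp only [ENNReal.toReal_zero] at h2
    exact h2.eventually (gt_mem_nhds (by linarith))
  have hβ : ∀ m : ℕ, ∃ b : ℕ, ∀ i ≥ b, (∀ s ∈ (Finset.range (m + 1)).powerset,
      |S.Pf (q i) (bump r hr (⋃ j ∈ s, K j)) x - S.Pf (q i) (bump r hr (⋃ j ∈ s, K j)) z|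
        < ε / 8) ∧ (S.P (q m) x).real (⋃ j ≥ i, thickening r (K j)) < ε / 8 := fun m =>
    eventually_atTop.1 ((hpast m).and (htail m))
  choose β hβ using hβ
  rw [frequently_atTop] at hcon
  choose g hg hgbad using hcon
  let φ : ℕ → ℕ := fun k => Nat.rec (g 0) (fun _ p => g (max (p + 1) (β p))) k
  have hφs : ∀ k, φ (k + 1) = g (max (φ k + 1) (β (φ k))) := fun k => rfl
  have hφ1 : ∀ k, φ k < φ (k + 1) := fun k => by
    have := hg (max (φ k + 1) (β (φ k)))
    rw [hφs]
    have h2 := le_max_left (φ k + 1) (β (φ k))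
    omega
  have hφ2 : ∀ k, β (φ k) ≤ φ (k + 1) := fun k => by
    have := hg (max (φ k + 1) (β (φ k)))
    rw [hφs]
    have h2 := le_max_right (φ k + 1) (β (φ k))
    omega
  have hbad : ∀ k, S.Pf (q (φ k)) (bump r hr (K (φ k))) x < ε / 2 := fun k => by
    cases k with
    | zero => exact not_le.1 (hgbad 0)
    | succ k => rw [hφs]; exact not_le.1 (hgbad _)
  have hmono : StrictMono φ := strictMono_nat_of_lt_succ hφ1
  have hlim := (((S.claimA_pt hE hL (bump_lip hr (⋃ k, K (φ k))) x z).comp hq').comp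
    hmono.tendsto_atTop).abs
  simp only [Function.comp_def, abs_zero] at hlim
  obtain ⟨k, hk, hk1⟩ := ((hlim.eventually (gt_mem_nhds (show 0 < ε / 8 by linarith))).and
    (eventually_ge_atTop 1)).exists
  obtain ⟨k, rfl⟩ : ∃ l, k = l + 1 := ⟨k - 1, by omega⟩
  have ht : (0 : ℝ) ≤ (q (φ (k + 1)) : ℝ) := Nat.cast_nonneg _
  set t : ℝ := (q (φ (k + 1)) : ℝ)
  set s : Finset ℕ := (Finset.range (k + 1)).image φ with hs
  have hsub : s ∈ (Finset.range (φ k + 1)).powerset := by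
    rw [Finset.mem_powerset]
    intro j hj
    rw [hs, Finset.mem_image] at hj
    obtain ⟨i, hi, rfl⟩ := hj
    have := hmono.monotone (Nat.lt_succ_iff.1 (Finset.mem_range.1 hi))
    exact Finset.mem_range.2 (by omega)
  set Past : Set X := ⋃ j ∈ s, K j with hPast
  have h1 := (hβ (φ k) _ (hφ2 k)).1 s hsub
  have h2 := (hβ (φ (k + 1)) _ (hφ2 (k + 1))).2
  set F : Set X := ⋃ j ≥ φ (k + 1 + 1), K j with hF
  have hA : (⋃ k, K (φ k)) ⊆ (Past ∪ K (φ (k + 1))) ∪ F := by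
    intro y hy
    obtain ⟨l, hl⟩ := mem_iUnion.1 hy
    rcases lt_trichotomy l (k + 1) with h | h | h
    · left; left
      exact mem_biUnion (Finset.mem_coe.2 (Finset.mem_image_of_mem φ (Finset.mem_range.2 h))) hl
    · left; right
      rwa [← h]
    · right
      exact mem_biUnion (show φ l ≥ φ (k + 1 + 1) from hmono.monotone h) hl
  have hA2 : Past ∪ K (φ (k + 1)) ⊆ (⋃ k, K (φ k)) := by
    refine union_subset ?_ (subset_iUnion (fun k => K (φ k)) (k + 1))
    refine iUnion₂_subset fun j hj => ?_
    obtain ⟨i, hi, rfl⟩ := Finset.mem_image.1 hj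
    exact subset_iUnion (fun k => K (φ k)) i
  have hd : Disjoint (thickening r Past) (thickening r (K (φ (k + 1)))) := by
    rw [hPast]
    simp only [thickening_iUnion, disjoint_iUnion_left]
    intro j hj
    obtain ⟨i, hi, rfl⟩ := Finset.mem_image.1 hj
    have hne : φ i ≠ φ (k + 1) := (hmono (Finset.mem_range.1 hi)).ne
    exact hdisj hne
  have e1 := S.Pf_bump_mono ht hr hA x
  have e2 := S.Pf_bump_union_le ht hr (Past ∪ K (φ (k + 1))) F x
  have e3 := S.Pf_bump_union_le ht hr Past (K (φ (k + 1))) x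
  have e4 : S.Pf t (bump r hr F) x ≤
      (S.P t x).real (⋃ j ≥ φ (k + 1 + 1), thickening r (K j)) := by
    refine S.Pf_bump_le ht hr ?_ ?_ x
    · exact (isOpen_biUnion fun _ _ => isOpen_thickening).measurableSet
    · rw [hF]
      simp only [thickening_iUnion]
      exact subset_rfl
  have e5 := S.Pf_bump_mono ht hr hA2 z
  have e6 := S.Pf_bump_add_le ht hr hd z
  have e7 := hz (φ (k + 1))
  have e8 := hbad (k + 1)
  rw [abs_lt] at h1 hk
  linarith [h1.1, h1.2, hk.1, hk.2]

theorem mul_real_le_integral {m : Measure X} [IsProbabilityMeasure m] {g : X → ℝ}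
    (hg : Measurable g) {M : ℝ} (hM : ∀ x, |g x| ≤ M) (h0 : ∀ x, 0 ≤ g x) {U : Set X}
    (hU : MeasurableSet U) {η : ℝ} (h : ∀ x ∈ U, η ≤ g x) : η * m.real U ≤ ∫ x, g x ∂m := by
  have : η * m.real U = ∫ x, U.indicator (fun _ => η) x ∂m := by
    rw [integral_indicator_const _ hU, smul_eq_mul, mul_comm]
  rw [this]
  refine integral_mono ((integrable_const η).indicator hU) (integrable_bdd hg hM) fun y => ?_
  by_cases hy : y ∈ U
  · simpa [hy] using h y hy
  · simpa [hy] using h0 y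

theorem Pf_bump_nonneg (S : MarkovFellerSemigroup X) {t : ℝ} {r : ℝ} (hr : 0 < r)
    (A : Set X) (x : X) : 0 ≤ S.Pf t (bump r hr A) x :=
  integral_nonneg (bump_nonneg hr A)

theorem no_hump (S : MarkovFellerSemigroup X) {z : X} (hE : S.EvContAt z) (hL : S.LowerBd z)
    {r : ℝ} (hr : 0 < r) {ε : ℝ} (hε : 0 < ε) (K : ℕ → Set X) (q : ℕ → ℕ)
    (hq : Tendsto q atTop atTop)
    (hdisj : Pairwise (Function.onFun Disjoint fun i => thickening r (K i)))
    (hz : ∀ i, ε ≤ S.Pf (q i) (bump r hr (K i)) z) : False := by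
  have hp : ∀ n : ℕ, IsProbabilityMeasure (S.P n z) := fun n => S.isProb n (Nat.cast_nonneg _) z
  set Z : Set X := {x | ∀ r > (0 : ℝ), ∃ a > (0 : ℝ), ∀ᶠ m : ℕ in atTop,
    a ≤ (S.P m z).real (ball x r)} with hZ
  have hzZ : z ∈ Z := by
    intro ρ hρ
    obtain ⟨c, hc, h⟩ := hL ρ hρ
    refine ⟨c / 2, by linarith, ?_⟩
    have : ∀ᶠ t in atTop, c / 2 < (S.P t z (ball z ρ)).toReal :=
      eventually_lt_of_lt_liminf (lt_of_lt_of_le (by linarith) (h z))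
      (isBoundedUnder_of ⟨0, fun t => ENNReal.toReal_nonneg⟩)
    exact (tendsto_natCast_atTop_atTop.eventually this).mono fun m hm => hm.le
  have hZc : IsClosed Z := by
    rw [← isSeqClosed_iff_isClosed]
    intro u x hu hux ρ hρ
    obtain ⟨n, hn⟩ := (hux.eventually (ball_mem_nhds x (half_pos hρ))).exists
    obtain ⟨a, ha, h⟩ := hu n (ρ / 2) (half_pos hρ)
    refine ⟨a, ha, h.mono fun m hm => hm.trans (measureReal_mono ?_)⟩
    refine ball_subset_ball' ?_
    have : dist (u n) x < ρ / 2 := hn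
    linarith
  have hsupp : ∀ n : ℕ, (S.P n z).support ⊆ Z := by
    intro n y hy ρ hρ
    have hn0 : (0 : ℝ) ≤ n := Nat.cast_nonneg n
    have hρ2 := half_pos hρ
    set g := bump (ρ / 2) hρ2 (ball y (ρ / 2)) with hg
    have hpos : 0 < S.Pf n g z := by
      refine lt_of_lt_of_le ?_ (S.le_Pf_bump hn0 hρ2 measurableSet_ball z)
      have := (Measure.mem_support_iff_forall y).1 hy _ (ball_mem_nhds y hρ2)
      exact ENNReal.toReal_pos this.ne' (measure_ne_top _ _)
    have hcont := S.Pf_bump_cont hn0 hρ2 (ball y (ρ / 2))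
    obtain ⟨σ, hσ, hball⟩ := Metric.eventually_nhds_iff_ball.1
      (hcont.continuousAt.eventually (lt_mem_nhds (half_lt_self hpos)))
    obtain ⟨a, ha, hev⟩ := hzZ σ hσ
    refine ⟨S.Pf n g z / 2 * a, by positivity, ?_⟩
    have : ∀ᶠ m : ℕ in atTop,
        S.Pf n g z / 2 * a ≤ (S.P ((m + n : ℕ) : ℝ) z).real (ball y ρ) := by
      filter_upwards [hev] with m hm
      have hm0 : (0 : ℝ) ≤ m := Nat.cast_nonneg m
      have e1 : S.Pf ((m + n : ℕ) : ℝ) g z ≤ (S.P ((m + n : ℕ) : ℝ) z).real (ball y ρ) := by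
        refine S.Pf_bump_le (Nat.cast_nonneg _) hρ2 measurableSet_ball ?_ z
        intro w hw
        obtain ⟨v, hv, hwv⟩ := mem_thickening_iff.1 hw
        rw [mem_ball] at *
        linarith [dist_triangle w v y]
      rw [Nat.cast_add, S.Pf_add hn0 hm0 z (bump_cont hρ2 _).measurable (bump_abs hρ2 _)] at e1
      have e2 := mul_real_le_integral (m := S.P m z) (hcont.measurable)
        (S.Pf_bound hn0 (bump_abs hρ2 _)) (S.Pf_bump_nonneg hρ2 _)
        (measurableSet_ball (x := z) (ε := σ)) (fun x hx => (hball x hx).le)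
      rw [Nat.cast_add]
      refine le_trans ?_ (e2.trans e1)
      exact mul_le_mul_of_nonneg_left hm (by positivity)
    rw [eventually_atTop] at this ⊢
    obtain ⟨b, hb⟩ := this
    refine ⟨b + n, fun m hm => ?_⟩
    have := hb (m - n) (by omega)
    rwa [Nat.sub_add_cancel (by omega)] at this
  have hfull : ∀ n : ℕ, ∀ᵐ y ∂(S.P n z), y ∈ Z := fun n =>
    mem_of_superset (Measure.support_mem_ae (μ := S.P n z)) (hsupp n)
  -- Baire category on `Z`
  have : Nonempty Z := ⟨⟨z, hzZ⟩⟩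
  have : CompleteSpace Z := hZc.completeSpace_coe
  obtain ⟨N, ⟨x₀, hx₀⟩⟩ := nonempty_interior_of_iUnion_of_closed
    (f := fun N : ℕ => {y : Z | ∀ i ≥ N, ε / 2 ≤ S.Pf (q i) (bump r hr (K i)) y})
    (fun N => by
      simp only [Set.ofPred_forall]
      refine isClosed_iInter fun i => isClosed_iInter fun _ => ?_
      exact isClosed_le continuous_const
        ((S.Pf_bump_cont (Nat.cast_nonneg _) hr (K i)).comp continuous_subtype_val))
    (by
      refine eq_univ_of_forall fun y => ?_
      obtain ⟨N, hN⟩ := eventually_atTop.1 (S.hump hE hL hr hε K q hq hdisj hz y)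
      exact mem_iUnion.2 ⟨N, hN⟩)
  obtain ⟨ρ, hρ, hsub⟩ := Metric.mem_nhds_iff.1 (mem_interior_iff_mem_nhds.1 hx₀)
  obtain ⟨a, ha, hev⟩ := x₀.2 ρ hρ
  obtain ⟨L, hL1⟩ := exists_nat_gt (1 / (ε / 2 * a))
  have hpos : 0 < ε / 2 * a := by positivity
  rw [div_lt_iff₀ hpos] at hL1
  obtain ⟨m₀, hm₀⟩ := eventually_atTop.1 hev
  set n : ℕ := m₀ + ∑ i ∈ Finset.Ico N (N + L), q i with hn
  have hkey : ∀ i ∈ Finset.Ico N (N + L), ε / 2 * a ≤ (S.P n z).real (thickening r (K i)) := by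
    intro i hi
    have hqi : q i ≤ ∑ i ∈ Finset.Ico N (N + L), q i :=
      Finset.single_le_sum (f := q) (fun _ _ => Nat.zero_le _) hi
    obtain ⟨m, hm⟩ : ∃ m, n = m + q i := ⟨n - q i, by omega⟩
    have hmm : m₀ ≤ m := by omega
    have e1 := S.Pf_bump_le (t := n) (Nat.cast_nonneg _) hr
      (isOpen_thickening (δ := r) (E := K i)).measurableSet subset_rfl z
    refine le_trans ?_ e1
    rw [hm, Nat.cast_add, S.Pf_add (Nat.cast_nonneg _) (Nat.cast_nonneg _) z
      (bump_cont hr _).measurable (bump_abs hr _)]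
    have e2 := mul_real_le_integral (m := S.P m z)
      (S.Pf_bump_cont (t := q i) (Nat.cast_nonneg _) hr (K i)).measurable
        (S.Pf_bound (Nat.cast_nonneg _) (bump_abs hr _)) (S.Pf_bump_nonneg hr _)
        ((measurableSet_ball (x := (x₀ : X)) (ε := ρ)).inter hZc.measurableSet) (η := ε / 2)
        (fun x hx => hsub (show (⟨x, hx.2⟩ : Z) ∈ ball x₀ ρ from hx.1) i
          (Finset.mem_Ico.1 hi).1)
    refine le_trans (mul_le_mul_of_nonneg_left ?_ (by linarith)) e2
    refine (hm₀ m hmm).trans (le_of_eq ?_)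
    refine measureReal_congr ?_
    filter_upwards [hfull m] with y hy
    exact propext ⟨fun h => ⟨h, hy⟩, fun h => h.1⟩
  have hsum : ∑ i ∈ Finset.Ico N (N + L), (S.P n z).real (thickening r (K i)) ≤ 1 := by
    rw [← measureReal_biUnion_finset (fun i _ j _ hij => hdisj hij)
      (fun i _ => isOpen_thickening.measurableSet)]
    exact measureReal_le_one
  have := Finset.sum_le_sum hkey
  simp only [Finset.sum_const, Nat.card_Ico, nsmul_eq_mul] at this
  rw [show N + L - N = L by omega] at this
  linarith


theorem tight_aux (S : MarkovFellerSemigroup X) {z : X} (hE : S.EvContAt z) (hL : S.LowerBd z)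
    {ε : ℝ} (hε : 0 < ε) : ∃ C : Set X, IsCompact C ∧ ∃ N : ℕ, ∀ n : ℕ, N ≤ n →
      S.P n z (thickening ε C)ᶜ ≤ ENNReal.ofReal ε := by
  by_contra hcon
  push Not at hcon
  have : SecondCountableTopology X := UniformSpace.secondCountable_of_separable X
  have hp : ∀ n : ℕ, IsProbabilityMeasure (S.P n z) := fun n => S.isProb n (Nat.cast_nonneg _) z
  obtain ⟨F, hF1, hF2⟩ := exists_seq_of_forall_finset_exists
    (fun p : Set X × ℕ => IsCompact p.1 ∧ ENNReal.ofReal ε < S.P p.2 z p.1)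
    (fun p p' => p.2 < p'.2 ∧ p'.1 ⊆ (thickening ε p.1)ᶜ) (by
      intro s hs
      obtain ⟨n, hn, h⟩ := hcon (⋃ p ∈ s, p.1) (s.isCompact_biUnion fun p hp => (hs p hp).1)
        (∑ p ∈ s, p.2 + 1)
      obtain ⟨K, hK, hKc, hKm⟩ := MeasurableSet.exists_lt_isCompact_of_ne_top
        (isOpen_thickening (δ := ε)).measurableSet.compl (measure_ne_top _ _) h
      refine ⟨(K, n), ⟨hKc, hKm⟩, fun p hp => ⟨?_, ?_⟩⟩
      · have := Finset.single_le_sum (f := fun p : Set X × ℕ => p.2) (fun _ _ => Nat.zero_le _) hp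
        simp only at this ⊢
        omega
      · refine hK.trans (compl_subset_compl.2 (thickening_subset_of_subset _ ?_))
        exact subset_biUnion_of_mem (u := fun p : Set X × ℕ => p.1) hp)
  have hmono : StrictMono fun i => (F i).2 := fun m n h => (hF2 m n h).1
  have hlt : ∀ m n, m < n → Disjoint (thickening (ε / 2) (F m).1) (thickening (ε / 2) (F n).1) := by
    intro m n h
    rw [Set.disjoint_left]
    intro y h1 h2
    obtain ⟨a, ha, hya⟩ := mem_thickening_iff.1 h1
    obtain ⟨b, hb, hyb⟩ := mem_thickening_iff.1 h2
    refine (hF2 m n h).2 hb (mem_thickening_iff.2 ⟨a, ha, ?_⟩)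
    have := dist_triangle_left b a y
    linarith
  refine S.no_hump hE hL (half_pos hε) hε (fun i => (F i).1) (fun i => (F i).2)
    hmono.tendsto_atTop ?_ ?_
  · intro m n hmn
    rcases lt_or_gt_of_ne hmn with h | h
    · exact hlt m n h
    · exact (hlt n m h).symm
  · intro i
    refine le_trans ?_ (S.le_Pf_bump (Nat.cast_nonneg _) (half_pos hε)
      (hF1 i).1.isClosed.measurableSet z)
    exact (ENNReal.ofReal_le_iff_le_toReal (measure_ne_top _ _)).1 (hF1 i).2.le

theorem tight_aux2 (S : MarkovFellerSemigroup X) {z : X} (hE : S.EvContAt z) (hL : S.LowerBd z)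
    {ε : ℝ} (hε : 0 < ε) : ∃ C : Set X, IsCompact C ∧ ∀ n : ℕ,
      S.P n z (thickening ε C)ᶜ ≤ ENNReal.ofReal ε := by
  have : SecondCountableTopology X := UniformSpace.secondCountable_of_separable X
  have hp : ∀ n : ℕ, IsProbabilityMeasure (S.P n z) := fun n => S.isProb n (Nat.cast_nonneg _) z
  obtain ⟨C, hC, N, hN⟩ := S.tight_aux hE hL hε
  have hD : ∀ n : ℕ, ∃ D : Set X, IsCompact D ∧ S.P n z Dᶜ ≤ ENNReal.ofReal ε := fun n => by
    obtain ⟨D, hD, h⟩ := isTightMeasureSet_iff_exists_isCompact_measure_compl_le.1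
      (isTightMeasureSet_singleton (μ := S.P n z)) (ENNReal.ofReal ε) (ENNReal.ofReal_pos.2 hε)
    exact ⟨D, hD, h _ rfl⟩
  choose D hDc hD using hD
  refine ⟨C ∪ ⋃ n ∈ Finset.range N, D n,
    hC.union ((Finset.range N).isCompact_biUnion fun n _ => hDc n), fun n => ?_⟩
  rcases le_or_gt N n with h | h
  · refine (measure_mono (compl_subset_compl.2 ?_)).trans (hN n h)
    exact thickening_subset_of_subset _ subset_union_left
  · refine (measure_mono (compl_subset_compl.2 ?_)).trans (hD n)
    refine Subset.trans ?_ (self_subset_thickening hε _)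
    exact (subset_biUnion_of_mem (u := D) (Finset.mem_coe.2 (Finset.mem_range.2 h))).trans
      subset_union_right

theorem tight (S : MarkovFellerSemigroup X) {z : X} (hE : S.EvContAt z) (hL : S.LowerBd z) :
    IsTightMeasureSet (Set.range fun n : ℕ => S.P n z) := by
  rw [isTightMeasureSet_iff_exists_isCompact_measure_compl_le]
  intro ε hε
  obtain ⟨e, he, hsum⟩ := ENNReal.exists_pos_sum_of_countable hε.ne' ℕ
  have hpos : ∀ m : ℕ, 0 < min (e m : ℝ) (1 / ((m : ℝ) + 1)) := fun m =>
    lt_min (NNReal.coe_pos.2 (he m)) (by positivity)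
  choose C hC hCm using fun m => S.tight_aux2 hE hL (hpos m)
  refine ⟨⋂ m, cthickening (min (e m : ℝ) (1 / ((m : ℝ) + 1))) (C m), ?_, ?_⟩
  · refine TotallyBounded.isCompact_of_isClosed ?_ (isClosed_iInter fun m => isClosed_cthickening)
    rw [Metric.totallyBounded_iff]
    intro δ hδ
    obtain ⟨m, hm⟩ := exists_nat_one_div_lt (half_pos hδ)
    obtain ⟨t, ht, hcov⟩ := Metric.totallyBounded_iff.1 (hC m).totallyBounded (δ / 2) (half_pos hδ)
    refine ⟨t, ht, fun y hy => ?_⟩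
    have hy' := mem_iInter.1 hy m
    have hy2 := cthickening_subset_thickening' (half_pos hδ)
      ((min_le_right _ _).trans_lt hm) (C m) hy'
    obtain ⟨a, ha, hya⟩ := mem_thickening_iff.1 hy2
    obtain ⟨b, hb, hab⟩ := mem_iUnion₂.1 (hcov ha)
    refine mem_iUnion₂.2 ⟨b, hb, ?_⟩
    rw [mem_ball] at *
    linarith [dist_triangle y a b]
  · rintro _ ⟨n, rfl⟩
    rw [compl_iInter]
    refine (measure_iUnion_le _).trans (le_trans (ENNReal.tsum_le_tsum fun m => ?_) hsum.le)
    refine (measure_mono (compl_subset_compl.2 (thickening_subset_cthickening _ _))).trans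
      ((hCm m n).trans ?_)
    refine (ENNReal.ofReal_le_ofReal (min_le_left _ _)).trans ?_
    simp

theorem prob_ext {μ ν : Measure X} [IsProbabilityMeasure μ] [IsProbabilityMeasure ν]
    (h : ∀ f : X → ℝ, IsBddLipschitz f → ∫ x, f x ∂μ = ∫ x, f x ∂ν) : μ = ν := by
  have : SecondCountableTopology X := UniformSpace.secondCountable_of_separable X
  let m : ProbabilityMeasure X := ⟨μ, inferInstance⟩
  let n : ProbabilityMeasure X := ⟨ν, inferInstance⟩
  have hne := nonempty_of_isProbabilityMeasure μ
  have ht : Tendsto (fun _ : ℕ => m) atTop (𝓝 n) := by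
    rw [tendsto_iff_forall_lipschitz_integral_tendsto]
    rintro f ⟨C, hC⟩ hf
    have : ∫ x, f x ∂μ = ∫ x, f x ∂ν := by
      refine h f ⟨hf, |f hne.some| + C, fun x => ?_⟩
      have := hC x hne.some
      rw [Real.dist_eq] at this
      have h2 := abs_sub_abs_le_abs_sub (f x) (f hne.some)
      linarith
    change Tendsto (fun _ : ℕ => ∫ x, f x ∂μ) atTop (𝓝 (∫ x, f x ∂ν))
    rw [this]
    exact tendsto_const_nhds
  have h2 := tendsto_nhds_unique ht tendsto_const_nhds
  exact (congrArg Subtype.val h2).symm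

theorem lip_bcf {f : X → ℝ} (hf : IsBddLipschitz f) :
    ∃ g : BoundedContinuousFunction X ℝ, ⇑g = f := by
  obtain ⟨⟨K, hK⟩, M, hM⟩ := hf
  exact ⟨BoundedContinuousFunction.ofNormedAddCommGroup f hK.continuous M hM, rfl⟩

theorem bcf_bdd (f : BoundedContinuousFunction X ℝ) (x : X) : |f x| ≤ ‖f‖ :=
  f.norm_coe_le_norm x

theorem exists_invariant (S : MarkovFellerSemigroup X) {z : X} (hE : S.EvContAt z)
    (hL : S.LowerBd z) : ∃ μ, S.Invariant μ := by
  let u : ℕ → ProbabilityMeasure X := fun n => ⟨S.P n z, S.isProb n (Nat.cast_nonneg _) z⟩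
  have hcomp : IsCompact (closure (Set.range u)) := by
    refine isCompact_closure_of_isTightMeasureSet ((S.tight hE hL).subset ?_)
    rintro _ ⟨_, ⟨n, rfl⟩, rfl⟩
    exact ⟨n, rfl⟩
  obtain ⟨μ, -, hμ⟩ := hcomp.exists_mapClusterPt (f := atTop) (u := u)
    (le_principal_iff.2 (mem_map.2 (univ_mem' fun n => subset_closure ⟨n, rfl⟩)))
  obtain ⟨U, hU, hlim⟩ := mapClusterPt_iff_ultrafilter.1 hμ
  rw [ProbabilityMeasure.tendsto_iff_forall_integral_tendsto] at hlim
  refine ⟨μ, inferInstance, fun s hs => ?_⟩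
  have hps := S.Pmeas_prob hs (μ : Measure X)
  refine prob_ext fun f hf => ?_
  obtain ⟨g, rfl⟩ := lip_bcf hf
  have hgm := g.continuous.measurable
  have hb := bcf_bdd g
  rw [S.integral_Pmeas hs _ hgm hb]
  let G : BoundedContinuousFunction X ℝ := BoundedContinuousFunction.ofNormedAddCommGroup
    (S.Pf s g) (S.feller g s hs) ‖g‖ (S.Pf_bound hs hb)
  have h1 : Tendsto (fun n : ℕ => ∫ x, S.Pf s g x ∂(S.P n z)) U
    (𝓝 (∫ x, S.Pf s g x ∂(μ : Measure X))) := hlim G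
  have h2 : Tendsto (fun n : ℕ => ∫ x, g x ∂(S.P n z)) U (𝓝 (∫ x, g x ∂(μ : Measure X))) := hlim g
  have hp := S.isProb s hs z
  have h3 := ((S.claimA hE hL hf (S.P s z) (Measure.dirac z)).comp
    tendsto_natCast_atTop_atTop).mono_left hU
  refine tendsto_nhds_unique h1 ?_
  have h4 := h3.add h2
  rw [zero_add] at h4
  refine h4.congr fun n => ?_
  have hn : (0 : ℝ) ≤ n := Nat.cast_nonneg n
  simp only [Function.comp_apply]
  rw [integral_dirac' _ _ (S.Pf_measurable hn hgm).stronglyMeasurable,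
    ← S.Pf_add hs hn z hgm hb, ← S.Pf_add hn hs z hgm hb, add_comm s]
  simp [Pf]

theorem stable_of_lower (S : MarkovFellerSemigroup X) {z : X} (hE : S.EvContAt z)
    (hL : S.LowerBd z) : S.AsympStable := by
  obtain ⟨μs, hinv⟩ := S.exists_invariant hE hL
  have hconst : ∀ ν, S.Invariant ν → ∀ f : X → ℝ, IsBddLipschitz f → ∀ t, 0 ≤ t →
      ∫ x, S.Pf t f x ∂ν = ∫ x, f x ∂ν := by
    intro ν hν f hf t ht
    have := hν.1
    obtain ⟨g, rfl⟩ := lip_bcf hf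
    rw [← S.integral_Pmeas ht ν g.continuous.measurable (bcf_bdd g), hν.2 t ht]
  have := hinv.1
  refine ⟨μs, hinv, fun ν hν => ?_, fun μ hμ => ?_⟩
  · have := hν.1
    refine prob_ext fun f hf => ?_
    have h := S.claimA hE hL hf ν μs
    have h2 : Tendsto (fun _ : ℝ => ∫ x, f x ∂ν - ∫ x, f x ∂μs) atTop (𝓝 0) := by
      refine h.congr' ?_
      filter_upwards [eventually_ge_atTop 0] with t ht
      rw [hconst ν hν f hf t ht, hconst μs hinv f hf t ht]
    exact sub_eq_zero.1 (tendsto_nhds_unique tendsto_const_nhds h2)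
  · let w : ℝ → ProbabilityMeasure X := fun t =>
      ⟨S.Pmeas (max t 0) μ, S.Pmeas_prob (le_max_right _ _) μ⟩
    let m : ProbabilityMeasure X := ⟨μs, inferInstance⟩
    have hw : Tendsto w atTop (𝓝 m) := by
      rw [tendsto_iff_forall_lipschitz_integral_tendsto]
      rintro f ⟨C, hC⟩ hf
      have hf' : IsBddLipschitz f := by
        refine ⟨hf, |f z| + C, fun x => ?_⟩
        have := hC x z
        rw [Real.dist_eq] at this
        have h2 := abs_sub_abs_le_abs_sub (f x) (f z)
        linarith
      obtain ⟨g, rfl⟩ := lip_bcf hf'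
      have h := (S.claimA hE hL hf' μ μs).add_const (∫ x, g x ∂μs)
      rw [zero_add] at h
      refine h.congr' ?_
      filter_upwards [eventually_ge_atTop 0] with t ht
      rw [hconst μs hinv g hf' t ht]
      change _ = ∫ x, g x ∂(S.Pmeas (max t 0) μ)
      rw [max_eq_left ht, S.integral_Pmeas ht μ g.continuous.measurable (bcf_bdd g)]
      ring
    rw [ProbabilityMeasure.tendsto_iff_forall_integral_tendsto] at hw
    intro f
    refine (hw f).congr' ?_
    filter_upwards [eventually_ge_atTop 0] with t ht
    change ∫ x, f x ∂(S.Pmeas (max t 0) μ) = _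
    rw [max_eq_left ht, S.integral_Pmeas ht μ f.continuous.measurable (bcf_bdd f)]

theorem evCont_of_stable (S : MarkovFellerSemigroup X) (h : S.AsympStable) :
    (∀ z : X, S.EvContAt z) ∧ ∃ z, S.LowerBd z := by
  obtain ⟨μs, hinv, -, hconv⟩ := h
  have hpr := hinv.1
  have : SecondCountableTopology X := UniformSpace.secondCountable_of_separable X
  have hpt : ∀ f : X → ℝ, IsBddLipschitz f → ∀ x,
      Tendsto (fun t => S.Pf t f x) atTop (𝓝 (∫ y, f y ∂μs)) := by
    intro f hf x
    obtain ⟨g, rfl⟩ := lip_bcf hf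
    refine (hconv (Measure.dirac x) inferInstance g).congr' ?_
    filter_upwards [eventually_ge_atTop 0] with t ht
    rw [integral_dirac' _ _ (S.Pf_measurable ht g.continuous.measurable).stronglyMeasurable]
  constructor
  · intro z f hf
    have : ∀ x, limsup (fun t => |S.Pf t f x - S.Pf t f z|) atTop = 0 := fun x => by
      have := ((hpt f hf x).sub (hpt f hf z)).abs
      rw [sub_self, abs_zero] at this
      exact this.limsup_eq
    simp only [this]
    exact limsup_const 0
  · obtain ⟨z, hz⟩ := Measure.nonempty_support (μ := μs) (IsProbabilityMeasure.ne_zero μs)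
    refine ⟨z, fun ε hε => ?_⟩
    have hε2 := half_pos hε
    set g := bump (ε / 2) hε2 (ball z (ε / 2)) with hg
    have hpos : 0 < ∫ y, g y ∂μs := by
      have h0 : 0 < μs.real (ball z (ε / 2)) :=
        ENNReal.toReal_pos ((Measure.mem_support_iff_forall z).1 hz _ (ball_mem_nhds z hε2)).ne'
          (measure_ne_top _ _)
      have := mul_real_le_integral (m := μs) (bump_cont hε2 (ball z (ε / 2))).measurable
        (bump_abs hε2 _) (bump_nonneg hε2 _) (measurableSet_ball (x := z) (ε := ε / 2)) (η := 1)
        (fun x hx => (bump_one hε2 hx).ge)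
      linarith
    refine ⟨(∫ y, g y ∂μs) / 2, half_pos hpos, fun x => ?_⟩
    refine le_liminf_of_le ?_ ?_
    · refine IsBoundedUnder.isCoboundedUnder_ge ⟨1, ?_⟩
      rw [eventually_map]
      filter_upwards [eventually_ge_atTop 0] with t ht
      have := S.isProb t ht x
      exact measureReal_le_one (μ := S.P t x)
    · filter_upwards [eventually_ge_atTop 0, (hpt g (bump_lip _ _) x).eventually
        (lt_mem_nhds (half_lt_self hpos))] with t ht h1
      refine h1.le.trans (S.Pf_bump_le ht hε2 measurableSet_ball ?_ x)
      intro w hw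
      obtain ⟨v, hv, hwv⟩ := mem_thickening_iff.1 hw
      rw [mem_ball] at *
      linarith [dist_triangle w v z]

theorem asympStable_iff_evCont_and_lower_bound (S : MarkovFellerSemigroup X) :
    (S.AsympStable ↔
      ((∀ z : X, S.EvContAt z) ∧
        ∃ z : X, ∀ ε > (0:ℝ), ∃ c > (0:ℝ), ∀ x : X,
          c ≤ liminf (fun t => (S.P t x (ball z ε)).toReal) atTop)) ∧
    (((∀ z : X, S.EvContAt z) ∧
        ∃ z : X, ∀ ε > (0:ℝ), ∃ c > (0:ℝ), ∀ x : X,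
          c ≤ liminf (fun t => (S.P t x (ball z ε)).toReal) atTop) ↔
      (∃ z : X, S.EvContAt z ∧ ∀ ε > (0:ℝ), ∃ c > (0:ℝ), ∀ x : X,
          c ≤ liminf (fun t => (S.P t x (ball z ε)).toReal) atTop)) := by
  refine ⟨⟨fun h => S.evCont_of_stable h, ?_⟩, ⟨?_, ?_⟩⟩
  · rintro ⟨hE, z, hL⟩
    exact S.stable_of_lower (hE z) hL
  · rintro ⟨hE, z, hL⟩
    exact ⟨z, hE z, hL⟩
  · rintro ⟨z, hE, hL⟩
    exact S.evCont_of_stable (S.stable_of_lower hE hL)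

end MarkovFellerSemigroup
end

section
/- Let (P_t)_{t≥0} be a Markov–Feller semigroup on a Polish space X, and suppose that for every x ∈ T the measures Q_t(x,·) converge weakly, as t → ∞, to a probability measure ε_x; let Φ : T → P(X) be defined by Φ(x) = ε_x, where P(X) carries the topology of weak convergence. If (P_t) is Cesàro eventually continuous on X, then Φ is continuous on T. Conversely, if Φ is continuous on T, then (P_t) is Cesàro eventually continuous at every point of the interior of T. -/
open MeasureTheory Filter Metric Set Topology
open scoped ENNReal

namespace MarkovFellerSemigroup

variable {X : Type*} [MetricSpace X] [CompleteSpace X]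
  [TopologicalSpace.SeparableSpace X] [MeasurableSpace X] [BorelSpace X]

theorem abs_Qf_le (S : MarkovFellerSemigroup X) (f : X → ℝ) (M : ℝ) (hM : ∀ x, |f x| ≤ M)
    (t : ℝ) (ht : 0 < t) (x : X) : |S.Qf t f x| ≤ M := by
  have h1 : ∀ s ∈ Set.uIoc (0:ℝ) t, ‖S.Pf s f x‖ ≤ M := by
    intro s hs
    rw [Set.uIoc_of_le ht.le] at hs
    haveI := S.isProb s hs.1.le x
    have := norm_integral_le_of_norm_le_const (μ := S.P s x) (f := f) (C := M)
      (Eventually.of_forall fun y => by simpa using hM y)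
    simpa [Pf] using this
  have h2 := intervalIntegral.norm_integral_le_of_norm_le_const h1
  rw [Real.norm_eq_abs, sub_zero, abs_of_pos ht] at h2
  rw [Qf, abs_mul, abs_of_pos (by positivity : 0 < 1 / t)]
  calc 1 / t * |∫ s in (0:ℝ)..t, S.Pf s f x| ≤ 1 / t * (M * t) := by gcongr
    _ = M := by field_simp

theorem limsup_Qf_eq (S : MarkovFellerSemigroup X)
    (e : X → ProbabilityMeasure X)
    (hconv : ∀ x ∈ S.Tset, ∀ f : BoundedContinuousFunction X ℝ,
      Tendsto (fun t => S.Qf t f x) atTop (𝓝 (∫ y, f y ∂(e x : Measure X))))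
    (f : X → ℝ) (hf : IsBddLipschitz f) (x z : X) (hx : x ∈ S.Tset) (hz : z ∈ S.Tset) :
    limsup (fun t => |S.Qf t f x - S.Qf t f z|) atTop =
      |∫ y, f y ∂(e x : Measure X) - ∫ y, f y ∂(e z : Measure X)| := by
  obtain ⟨⟨K, hK⟩, M, hM⟩ := hf
  let F : BoundedContinuousFunction X ℝ :=
    BoundedContinuousFunction.ofNormedAddCommGroup f hK.continuous M (by simpa using hM)
  exact ((hconv x hx F).sub (hconv z hz F)).abs.limsup_eq

theorem continuousOn_limit_map_iff_cesaroEvCont (S : MarkovFellerSemigroup X)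
    (e : X → ProbabilityMeasure X)
    (hconv : ∀ x ∈ S.Tset, ∀ f : BoundedContinuousFunction X ℝ,
      Tendsto (fun t => S.Qf t f x) atTop (𝓝 (∫ y, f y ∂(e x : Measure X)))) :
    ((∀ z : X, S.CesaroEvContAt z) → ContinuousOn e S.Tset) ∧
    (ContinuousOn e S.Tset → ∀ z ∈ interior S.Tset, S.CesaroEvContAt z) := by
  constructor
  · intro h z hz
    rw [ContinuousWithinAt, tendsto_iff_forall_lipschitz_integral_tendsto]
    rintro f ⟨C, hC⟩ hL
    have hf : IsBddLipschitz f := by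
      refine ⟨hL, |f z| + C, fun x => ?_⟩
      have h1 := hC x z
      rw [Real.dist_eq] at h1
      have h2 := abs_sub_abs_le_abs_sub (f x) (f z)
      linarith
    obtain ⟨M, hM⟩ := hf.2
    have hev : ∀ x, ∀ᶠ t in atTop, |S.Qf t f x - S.Qf t f z| ≤ M + M := by
      intro x
      filter_upwards [eventually_gt_atTop (0:ℝ)] with t ht
      exact (abs_sub _ _).trans (add_le_add (S.abs_Qf_le f M hM t ht x)
        (S.abs_Qf_le f M hM t ht z))
    have hb : ∀ x, limsup (fun t => |S.Qf t f x - S.Qf t f z|) atTop ≤ M + M := by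
      intro x
      refine limsup_le_of_le ?_ (hev x)
      exact IsCoboundedUnder.of_frequently_ge (a := 0)
        (Frequently.of_forall fun t => abs_nonneg _)
    rw [Metric.tendsto_nhds]
    intro ε hε
    have h3 := eventually_lt_of_limsup_lt (b := ε) (f := 𝓝 z)
      (u := fun x => limsup (fun t => |S.Qf t f x - S.Qf t f z|) atTop)
      (by rw [h z f hf]; exact hε) ⟨M + M, by simpa using Eventually.of_forall hb⟩
    filter_upwards [nhdsWithin_le_nhds h3, self_mem_nhdsWithin] with x hx hxT
    rw [S.limsup_Qf_eq e hconv f hf x z hxT hz] at hx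
    rw [Real.dist_eq]
    exact hx
  · intro h z hz f hf
    have hzT := interior_subset hz
    have hc : Tendsto e (𝓝 z) (𝓝 (e z)) := h.continuousAt (mem_interior_iff_mem_nhds.1 hz)
    rw [ProbabilityMeasure.tendsto_iff_forall_integral_tendsto] at hc
    obtain ⟨⟨K, hK⟩, M, hM⟩ := id hf
    let F : BoundedContinuousFunction X ℝ :=
      BoundedContinuousFunction.ofNormedAddCommGroup f hK.continuous M (by simpa using hM)
    have h1 := ((hc F).sub_const (∫ y, F y ∂(e z : Measure X))).abs
    rw [sub_self, abs_zero] at h1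
    refine Tendsto.limsup_eq (h1.congr' ?_)
    filter_upwards [mem_interior_iff_mem_nhds.1 hz] with x hx
    exact (S.limsup_Qf_eq e hconv f hf x z hx hzT).symm

end MarkovFellerSemigroup
end

section
/- Let (P_t)_{t≥0} be a Markov–Feller semigroup on a Polish space X that is Cesàro eventually continuous on X, and assume there is a compact set K ⊆ X such that for every ε > 0 and every x ∈ X, limsup_{t→∞} Q_t(x, K^ε) > 0, where K^ε denotes the open ε-neighborhood of K. Then the set P_erg of ergodic invariant probability measures of (P_t) is compact in P(X) with the topology of weak convergence. -/
open MeasureTheory Filter Metric Set Topology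
open scoped ENNReal

set_option linter.all false

namespace MarkovFellerSemigroup

section Helpers

open ProbabilityTheory BoundedContinuousFunction

variable {Y : Type*} [MetricSpace Y] [SecondCountableTopology Y] [MeasurableSpace Y] [BorelSpace Y]

theorem integral_bind_bcf {A : Type*} [MeasurableSpace A] (m : Measure A) [IsProbabilityMeasure m]
    (κ : A → Measure Y) (hκ : Measurable κ) [∀ a, IsProbabilityMeasure (κ a)] (f : Y →ᵇ ℝ) :
    ∫ y, f y ∂(m.bind κ) = ∫ a, ∫ y, f y ∂(κ a) ∂m := by
  let k : Kernel A Y := ⟨κ, hκ⟩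
  have : IsMarkovKernel k := ⟨fun a => by change IsProbabilityMeasure (κ a); infer_instance⟩
  have h : m.bind κ = (k ∘ₖ Kernel.const Unit m) () := by
    rw [Kernel.comp_apply]; simp [k]
  have := ProbabilityTheory.Kernel.integral_comp (η := k) (κ := Kernel.const Unit m) (a := ())
    (f := f) (f.integrable _)
  rw [h, this]
  simp [k]

theorem bind_isProb {A : Type*} [MeasurableSpace A] (m : Measure A) [IsProbabilityMeasure m]
    (κ : A → Measure Y) (hκ : Measurable κ) [∀ a, IsProbabilityMeasure (κ a)] :
    IsProbabilityMeasure (m.bind κ) := by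
  constructor
  rw [Measure.bind_apply MeasurableSet.univ hκ.aemeasurable]
  simp

/-- joint kernel -/
noncomputable def pk (S : MarkovFellerSemigroup Y) (q : ℝ × Y) : Measure Y := S.P (max q.1 0) q.2

instance pk_prob (S : MarkovFellerSemigroup Y) (q : ℝ × Y) : IsProbabilityMeasure (S.pk q) :=
  S.isProb _ (le_max_right _ _) _

theorem measurable_pk_bcf (S : MarkovFellerSemigroup Y) (f : Y →ᵇ ℝ) :
    Measurable fun q => ∫ y, f y ∂S.pk q := by
  have := measurable_uncurry_of_continuous_of_measurable
    (u := fun (x : Y) (s : ℝ) => ∫ y, f y ∂S.P (max s 0) x)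
    (fun s => S.feller f _ (le_max_right _ _))
    (fun x => (S.measurable_t f x).comp (measurable_id.max measurable_const))
  exact this.comp measurable_swap

theorem measurable_pk (S : MarkovFellerSemigroup Y) : Measurable S.pk := by
  refine Measurable.measure_of_isPiSystem_of_isProbabilityMeasure (S := {s : Set Y | IsClosed s})
    ?_ isPiSystem_isClosed ?_
  · rw [BorelSpace.measurable_eq (α := Y), borel_eq_generateFrom_isClosed]
  · intro F hF
    have hδ : ∀ n : ℕ, (0:ℝ) < 1 / ((n:ℝ) + 1) := fun n => by positivity
    refine measurable_of_tendsto_metrizable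
      (f := fun n q => ENNReal.ofReal (∫ y, (thickenedIndicator (hδ n) F y : ℝ) ∂S.pk q)) ?_ ?_
    · intro n
      let g : Y →ᵇ ℝ := BoundedContinuousFunction.ofNormedAddCommGroup
        (fun y => (thickenedIndicator (hδ n) F y : ℝ)) (by fun_prop) 1
        (fun y => by simpa using! thickenedIndicator_le_one (hδ n) F y)
      exact (S.measurable_pk_bcf g).ennreal_ofReal
    · rw [tendsto_pi_nhds]
      intro q
      have := tendsto_integral_thickenedIndicator_of_isClosed (S.pk q) hF hδ
        tendsto_one_div_add_atTop_nhds_zero_nat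
      have := ENNReal.tendsto_ofReal this
      simpa using this

/-- uniform time measure -/
noncomputable def tau (t : ℝ) : Measure ℝ := (ENNReal.ofReal t)⁻¹ • volume.restrict (Ioc 0 t)

theorem tau_prob {t : ℝ} (ht : 0 < t) : IsProbabilityMeasure (tau t) := by
  constructor
  simp only [tau, Measure.smul_apply, MeasurableSet.univ, Measure.restrict_apply, univ_inter,
    Real.volume_Ioc, sub_zero, smul_eq_mul]
  exact ENNReal.inv_mul_cancel (by simpa using ht) ENNReal.ofReal_ne_top

theorem integral_tau {t : ℝ} (ht : 0 < t) (g : ℝ → ℝ) :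
    ∫ s, g s ∂(tau t) = (1 / t) * ∫ s in (0:ℝ)..t, g s := by
  rw [tau, integral_smul_measure, intervalIntegral.integral_of_le ht.le]
  simp [ENNReal.toReal_inv, ENNReal.toReal_ofReal ht.le]

/-- averaged measure -/
noncomputable def Qm (S : MarkovFellerSemigroup Y) (t : ℝ) (ν : Measure Y) : Measure Y :=
  ((tau t).prod ν).bind S.pk

theorem Qm_prob (S : MarkovFellerSemigroup Y) {t : ℝ} (ht : 0 < t) (ν : Measure Y)
    [IsProbabilityMeasure ν] : IsProbabilityMeasure (S.Qm t ν) := by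
  have := tau_prob ht
  exact bind_isProb _ _ S.measurable_pk

theorem tau_ae (t : ℝ) : ∀ᵐ s ∂(tau t), 0 < s := by
  refine Measure.ae_smul_measure ?_ _
  filter_upwards [ae_restrict_mem measurableSet_Ioc] with s hs using hs.1

theorem Pf_bound_s18 (S : MarkovFellerSemigroup Y) (f : Y →ᵇ ℝ) {s : ℝ} (hs : 0 ≤ s) (x : Y) :
    |S.Pf s f x| ≤ ‖f‖ := by
  have := S.isProb s hs x
  exact f.norm_integral_le_norm _

theorem Pf_pk (S : MarkovFellerSemigroup Y) (f : Y →ᵇ ℝ) {s : ℝ} (hs : 0 ≤ s) (x : Y) :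
    ∫ y, f y ∂S.pk (s, x) = S.Pf s f x := by
  simp [pk, Pf, max_eq_left hs]

theorem Qf_eq (S : MarkovFellerSemigroup Y) (f : Y →ᵇ ℝ) {t : ℝ} (ht : 0 < t) (x : Y) :
    S.Qf t f x = ∫ s, ∫ y, f y ∂S.pk (s, x) ∂(tau t) := by
  rw [Qf, ← integral_tau ht]
  refine integral_congr_ae ?_
  filter_upwards [tau_ae t] with s hs
  rw [S.Pf_pk f hs.le]

theorem integrable_pk (S : MarkovFellerSemigroup Y) (f : Y →ᵇ ℝ) (m : Measure (ℝ × Y))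
    [IsFiniteMeasure m] : Integrable (fun q => ∫ y, f y ∂S.pk q) m :=
  Integrable.of_bound (S.measurable_pk_bcf f).aestronglyMeasurable ‖f‖
    (ae_of_all _ fun q => f.norm_integral_le_norm _)

theorem Qf_meas (S : MarkovFellerSemigroup Y) (f : Y →ᵇ ℝ) {t : ℝ} (ht : 0 < t) :
    Measurable (fun x => S.Qf t f x) := by
  have := tau_prob ht
  have : (fun x => S.Qf t f x) = fun x => ∫ s, ∫ y, f y ∂S.pk (s, x) ∂(tau t) :=
    funext fun x => S.Qf_eq f ht x
  rw [this]
  exact ((S.measurable_pk_bcf f).comp measurable_swap).stronglyMeasurable.integral_prod_right'.measurable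

theorem Qf_bound (S : MarkovFellerSemigroup Y) (f : Y →ᵇ ℝ) {t : ℝ} (ht : 0 < t) (x : Y) :
    |S.Qf t f x| ≤ ‖f‖ := by
  have := tau_prob ht
  rw [S.Qf_eq f ht]
  have := norm_integral_le_of_norm_le_const (μ := tau t) (C := ‖f‖)
    (f := fun s => ∫ y, f y ∂S.pk (s, x)) (ae_of_all _ fun s => f.norm_integral_le_norm _)
  simpa using this

theorem integral_Qm (S : MarkovFellerSemigroup Y) (f : Y →ᵇ ℝ) {t : ℝ} (ht : 0 < t)
    (ν : Measure Y) [IsProbabilityMeasure ν] :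
    ∫ y, f y ∂(S.Qm t ν) = ∫ x, S.Qf t f x ∂ν := by
  have := tau_prob ht
  rw [Qm, integral_bind_bcf _ _ S.measurable_pk, integral_prod_symm _ (S.integrable_pk f _)]
  refine integral_congr_ae (ae_of_all _ fun x => ?_)
  exact (S.Qf_eq f ht x).symm

theorem integral_Qm' (S : MarkovFellerSemigroup Y) (f : Y →ᵇ ℝ) {t : ℝ} (ht : 0 < t)
    (ν : Measure Y) [IsProbabilityMeasure ν] :
    ∫ y, f y ∂(S.Qm t ν) = (1 / t) * ∫ s in (0:ℝ)..t, ∫ x, (∫ y, f y ∂S.pk (s, x)) ∂ν := by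
  have := tau_prob ht
  rw [Qm, integral_bind_bcf _ _ S.measurable_pk, integral_prod _ (S.integrable_pk f _),
    integral_tau ht]

theorem Qm_mono (S : MarkovFellerSemigroup Y) {t : ℝ} (ht : 0 < t) (ν μ : Measure Y)
    [IsFiniteMeasure ν] [IsFiniteMeasure μ]
    (c : ℝ≥0∞) (h : ν ≤ c • μ) (hμ : S.Invariant μ) : S.Qm t ν ≤ c • μ := by
  have := tau_prob ht
  rw [Measure.le_iff]
  intro A hA
  have hm : Measurable fun q => S.pk q A := (Measure.measurable_coe hA).comp S.measurable_pk
  rw [Qm, Measure.bind_apply hA S.measurable_pk.aemeasurable,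
    lintegral_prod _ hm.aemeasurable]
  calc ∫⁻ s, ∫⁻ x, S.pk (s, x) A ∂ν ∂(tau t)
      ≤ ∫⁻ s, c * μ A ∂(tau t) := by
        refine lintegral_mono_ae ?_
        filter_upwards [tau_ae t] with s hs
        calc ∫⁻ x, S.pk (s, x) A ∂ν ≤ ∫⁻ x, S.pk (s, x) A ∂(c • μ) :=
              lintegral_mono' h le_rfl
          _ = c * ∫⁻ x, S.P s x A ∂μ := by
              rw [lintegral_smul_measure]; simp [pk, max_eq_left hs.le]
          _ = c * μ A := by
              rw [← Measure.bind_apply hA (S.measurable_x s hs.le).aemeasurable]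
              congr 2
              exact hμ.2 s hs.le
    _ = (c • μ) A := by simp

/-- invariance in terms of integrals -/
theorem invariant_iff (S : MarkovFellerSemigroup Y) (μ : Measure Y) [IsProbabilityMeasure μ] :
    S.Invariant μ ↔ ∀ t, 0 ≤ t → ∀ f : Y →ᵇ ℝ, ∫ x, S.Pf t f x ∂μ = ∫ x, f x ∂μ := by
  have key : ∀ t, 0 ≤ t → ∀ f : Y →ᵇ ℝ, ∫ x, f x ∂(S.Pmeas t μ) = ∫ x, S.Pf t f x ∂μ := by
    intro t ht f
    have := fun x => S.isProb t ht x
    exact integral_bind_bcf μ _ (S.measurable_x t ht) f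
  constructor
  · intro h t ht f
    rw [← key t ht, h.2 t ht]
  · intro h
    refine ⟨inferInstance, fun t ht => ?_⟩
    have := fun x => S.isProb t ht x
    have : IsProbabilityMeasure (S.Pmeas t μ) := bind_isProb _ _ (S.measurable_x t ht)
    refine ext_of_forall_integral_eq_of_IsFiniteMeasure fun f => ?_
    rw [key t ht, h t ht]

/-- `P_t f` as bounded continuous function -/
noncomputable def Pb (S : MarkovFellerSemigroup Y) (f : Y →ᵇ ℝ) (t : ℝ) (ht : 0 ≤ t) : Y →ᵇ ℝ :=
  BoundedContinuousFunction.ofNormedAddCommGroup (S.Pf t f) (S.feller f t ht) ‖f‖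
    (fun x => S.Pf_bound_s18 f ht x)

theorem isClosed_invariant (S : MarkovFellerSemigroup Y) :
    IsClosed {μ : ProbabilityMeasure Y | S.Invariant (μ : Measure Y)} := by
  have : {μ : ProbabilityMeasure Y | S.Invariant (μ : Measure Y)} =
      ⋂ (t : ℝ) (ht : 0 ≤ t) (f : Y →ᵇ ℝ), {μ : ProbabilityMeasure Y |
        ∫ x, S.Pb f t ht x ∂(μ : Measure Y) = ∫ x, f x ∂(μ : Measure Y)} := by
    ext μ
    simp only [mem_ofPred_eq, mem_iInter]
    exact S.invariant_iff _
  rw [this]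
  refine isClosed_iInter fun t => isClosed_iInter fun ht => isClosed_iInter fun f => ?_
  exact isClosed_eq (ProbabilityMeasure.continuous_integral_boundedContinuousFunction _)
    (ProbabilityMeasure.continuous_integral_boundedContinuousFunction _)

theorem integral_Qf_inv (S : MarkovFellerSemigroup Y) (μ : Measure Y) [IsProbabilityMeasure μ]
    (h : S.Invariant μ) (f : Y →ᵇ ℝ) {t : ℝ} (ht : 0 < t) :
    ∫ x, S.Qf t f x ∂μ = ∫ x, f x ∂μ := by
  have := tau_prob ht
  rw [← S.integral_Qm f ht, S.integral_Qm' f ht, ← integral_tau ht]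
  calc _ = ∫ s, (∫ x, f x ∂μ) ∂(tau t) := by
        refine integral_congr_ae ?_
        filter_upwards [tau_ae t] with s hs
        simp_rw [S.Pf_pk f hs.le]
        exact (S.invariant_iff μ).1 h s hs.le f
    _ = _ := by simp

theorem Pf_add_s18 (S : MarkovFellerSemigroup Y) (f : Y →ᵇ ℝ) {s r : ℝ} (hs : 0 ≤ s) (hr : 0 ≤ r)
    (x : Y) : S.Pf s (S.Pb f r hr) x = S.Pf (s + r) f x := by
  have := S.isProb s hs x
  have := fun x => S.isProb r hr x
  rw [Pf, Pf, S.semigroup r s hr hs x, integral_bind_bcf _ _ (S.measurable_x r hr)]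
  rfl

theorem asymp_inv (S : MarkovFellerSemigroup Y) (f : Y →ᵇ ℝ) {t r : ℝ} (ht : 0 < t) (hr : 0 ≤ r)
    (ν : Measure Y) [IsProbabilityMeasure ν] :
    |∫ y, S.Pb f r hr y ∂(S.Qm t ν) - ∫ y, f y ∂(S.Qm t ν)| ≤ 2 * ‖f‖ * r / t := by
  have := tau_prob ht
  rw [S.integral_Qm' _ ht, S.integral_Qm' _ ht]
  set g : ℝ → ℝ := fun s => ∫ x, (∫ y, f y ∂S.pk (s, x)) ∂ν with hg
  have gb : ∀ s, ‖g s‖ ≤ ‖f‖ := by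
    intro s
    refine (norm_integral_le_of_norm_le_const (C := ‖f‖) (ae_of_all _ fun s => ?_)).trans (by simp)
    exact f.norm_integral_le_norm _
  have gm : Measurable g :=
    (S.measurable_pk_bcf f).stronglyMeasurable.integral_prod_right'.measurable
  have gi : ∀ a b, IntervalIntegrable g volume a b := by
    intro a b
    rw [intervalIntegrable_iff]
    have : IsFiniteMeasure (volume.restrict (uIoc a b)) := by
      rw [isFiniteMeasure_restrict, uIoc]; simp
    exact Integrable.of_bound gm.aestronglyMeasurable ‖f‖ (ae_of_all _ gb)
  have e : ∫ s in (0:ℝ)..t, ∫ x, (∫ y, S.Pb f r hr y ∂S.pk (s, x)) ∂ν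
      = ∫ s in (0:ℝ)..t, g (s + r) := by
    refine intervalIntegral.integral_congr fun s hs => ?_
    rw [uIcc_of_le ht.le] at hs
    simp only [hg]
    refine integral_congr_ae (ae_of_all _ fun x => ?_)
    simp only
    rw [S.Pf_pk _ hs.1, S.Pf_pk _ (add_nonneg hs.1 hr), S.Pf_add_s18 f hs.1 hr]
  rw [e, intervalIntegral.integral_comp_add_right, ← mul_sub,
    intervalIntegral.integral_interval_sub_interval_comm (gi _ _) (gi _ _) (gi _ _)]
  have b1 := intervalIntegral.norm_integral_le_of_norm_le_const (f := g) (a := 0 + r) (b := 0)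
    (fun s _ => gb s)
  have b2 := intervalIntegral.norm_integral_le_of_norm_le_const (f := g) (a := t + r) (b := t)
    (fun s _ => gb s)
  have e1 : |0 - (0 + r)| = r := by rw [abs_sub_comm]; simp [abs_of_nonneg hr]
  have e2 : |t - (t + r)| = r := by rw [abs_sub_comm]; simp [abs_of_nonneg hr]
  rw [e1] at b1
  rw [e2] at b2
  rw [abs_mul, abs_of_pos (by positivity : 0 < 1 / t)]
  have := (norm_sub_le (∫ s in (0 + r)..0, g s) (∫ s in (t + r)..t, g s)).trans (add_le_add b1 b2)
  rw [Real.norm_eq_abs] at this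
  calc _ ≤ 1 / t * (‖f‖ * r + ‖f‖ * r) := by gcongr
    _ = _ := by ring

end Helpers

section Helpers2

open ProbabilityTheory BoundedContinuousFunction

variable {Y : Type*} [MetricSpace Y] [SecondCountableTopology Y] [MeasurableSpace Y] [BorelSpace Y]

theorem evcont (S : MarkovFellerSemigroup Y) {z : Y} (hz : S.CesaroEvContAt z) (f : Y →ᵇ ℝ)
    {L : NNReal} (hf : LipschitzWith L f) {δ : ℝ} (hδ : 0 < δ) :
    ∀ᶠ x in 𝓝 z, ∀ᶠ t in atTop, |S.Qf t f x - S.Qf t f z| < δ := by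
  have h0 := hz f ⟨⟨L, hf⟩, ‖f‖, fun x => f.norm_coe_le_norm x⟩
  have hb : ∀ x, ∀ᶠ t in atTop, |S.Qf t f x - S.Qf t f z| ≤ 2 * ‖f‖ := by
    intro x
    filter_upwards [eventually_gt_atTop 0] with t ht
    have h1 := abs_le.1 (S.Qf_bound f ht x)
    have h2 := abs_le.1 (S.Qf_bound f ht z)
    rw [abs_le]; constructor <;> linarith
  have hcob : ∀ x, IsCoboundedUnder (· ≤ ·) atTop (fun t => |S.Qf t f x - S.Qf t f z|) :=
    fun x => IsCoboundedUnder.of_frequently_ge (a := 0)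
      (Frequently.of_forall fun t => abs_nonneg _)
  have hG : ∀ x, limsup (fun t => |S.Qf t f x - S.Qf t f z|) atTop ≤ 2 * ‖f‖ :=
    fun x => limsup_le_of_le (hcob x) (hb x)
  have := eventually_lt_of_limsup_lt (lt_of_eq_of_lt h0 hδ) (isBoundedUnder_of ⟨_, hG⟩)
  filter_upwards [this] with x hx
  exact eventually_lt_of_limsup_lt hx ⟨_, eventually_map.2 (hb x)⟩

theorem invariant_add_aux (S : MarkovFellerSemigroup Y) {t : ℝ} (ht : 0 ≤ t) (a b : Measure Y)
    (c d : ℝ≥0∞) : (c • a + d • b).bind (S.P t) = c • a.bind (S.P t) + d • b.bind (S.P t) := by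
  ext A hA
  have hm := S.measurable_x t ht
  simp only [Measure.add_apply, Measure.smul_apply, Measure.bind_apply hA hm.aemeasurable,
    lintegral_add_measure, lintegral_smul_measure]

theorem ergodic_extreme (S : MarkovFellerSemigroup Y) (μ ν : Measure Y) (hμ : S.ErgodicInv μ)
    (hν : S.Invariant ν) (c : ℝ≥0∞) (hc0 : c ≠ 0) (hc1 : c ≤ 1) (hle : c • ν ≤ μ) : ν = μ := by
  obtain ⟨⟨hp, hi⟩, he⟩ := hμ
  have := hν.1
  have hct : c ≠ ∞ := ne_top_of_le_ne_top ENNReal.one_ne_top hc1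
  have hfin : IsFiniteMeasure (c • ν) := isFiniteMeasure_of_le μ hle
  set ρ := μ - c • ν with hρ
  have hsum : ρ + c • ν = μ := Measure.sub_add_cancel_of_le hle
  have hρfin : IsFiniteMeasure ρ := isFiniteMeasure_of_le μ (by rw [← hsum]; exact Measure.le_add_right le_rfl)
  have hρi : ∀ t, 0 ≤ t → ρ.bind (S.P t) = ρ := by
    intro t ht
    have h1 := S.invariant_add_aux ht ρ ν 1 c
    rw [one_smul, hsum] at h1
    have h2 : μ.bind (S.P t) = μ := hi t ht
    have h3 : ν.bind (S.P t) = ν := hν.2 t ht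
    rw [h2, h3, one_smul] at h1
    ext A hA
    have h4 : (ρ + c • ν) A = (ρ.bind (S.P t) + c • ν) A := by rw [hsum, ← h1]
    rw [Measure.add_apply, Measure.add_apply] at h4
    exact ((ENNReal.add_left_inj (measure_ne_top _ _)).1 h4).symm
  have hcsum : (1 - c) + c = 1 := tsub_add_cancel_of_le hc1
  have i1 : S.Invariant ((1 - c) • μ + c • ν) := by
    refine ⟨⟨?_⟩, fun t ht => ?_⟩
    · simp [hcsum]
    · have h2 : μ.bind (S.P t) = μ := hi t ht
      have h3 : ν.bind (S.P t) = ν := hν.2 t ht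
      rw [Pmeas, S.invariant_add_aux ht, h2, h3]
  have i2 : S.Invariant (c • μ + (1:ℝ≥0∞) • ρ) := by
    refine ⟨⟨?_⟩, fun t ht => ?_⟩
    · have : (ρ + c • ν) univ = 1 := by rw [hsum]; simp
      simpa [add_comm] using this
    · have h2 : μ.bind (S.P t) = μ := hi t ht
      rw [Pmeas, S.invariant_add_aux ht, h2, hρi t ht]
  have hmid : μ = (2 : ℝ≥0∞)⁻¹ • (((1 - c) • μ + c • ν) + (c • μ + (1:ℝ≥0∞) • ρ)) := by
    have : ((1 - c) • μ + c • ν) + (c • μ + (1:ℝ≥0∞) • ρ) = ((1 - c) + c) • μ + (ρ + c • ν) := by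
      rw [add_smul, one_smul]; abel
    rw [this, hsum, hcsum, one_smul, ← two_smul ℝ≥0∞ μ, smul_smul,
      ENNReal.inv_mul_cancel (by simp) (by simp), one_smul]
  have hfinal := (he _ _ i1 i2 hmid).1
  ext A hA
  have h5 : ((1 - c) • μ + c • ν) A = ((1 - c) • μ + c • μ) A := by
    rw [hfinal, ← add_smul, hcsum, one_smul]
  simp only [Measure.add_apply, Measure.smul_apply, smul_eq_mul] at h5
  have h6 : (1 - c) * μ A ≠ ∞ := ENNReal.mul_ne_top (by finiteness) (measure_ne_top _ _)
  have h7 := (ENNReal.add_right_inj h6).1 h5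
  exact (ENNReal.mul_right_inj hc0 hct).1 h7

theorem ergodic_upper [CompleteSpace Y] (S : MarkovFellerSemigroup Y)
    (h : ∀ z : Y, S.CesaroEvContAt z)
    (μ : Measure Y) (hμ : S.ErgodicInv μ) {y : Y} (hy : y ∈ μ.support) (f : Y →ᵇ ℝ)
    {L : NNReal} (hf : LipschitzWith L f) {δ : ℝ} (hδ : 0 < δ) :
    ∀ᶠ t in atTop, S.Qf t f y < ∫ x, f x ∂μ + δ := by
  have hp := hμ.1.1
  by_contra hcon
  rw [not_eventually] at hcon
  have hcon' := (hcon.and_eventually (eventually_gt_atTop 0))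
  obtain ⟨t, ht, htt⟩ := exists_seq_forall_of_frequently hcon'
  set m := ∫ x, f x ∂μ with hm
  obtain ⟨r, hr, hB⟩ := Metric.eventually_nhds_iff_ball.1 (S.evcont (h y) f hf (half_pos hδ))
  set B := ball y r with hBdef
  have hBm : MeasurableSet B := measurableSet_ball
  have hBpos : 0 < μ B := (Measure.mem_support_iff_forall y).1 hy B (ball_mem_nhds y hr)
  set c := μ B with hc
  have hc1 : c ≤ 1 := prob_le_one
  set μB := μ[|B] with hμB
  have hpB : IsProbabilityMeasure μB := cond_isProbabilityMeasure hBpos.ne'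
  have hBle : μB ≤ c⁻¹ • μ := by
    rw [hμB, ProbabilityTheory.cond]
    gcongr
    exact Measure.restrict_le_self
  have hprob : ∀ k, IsProbabilityMeasure (S.Qm (t k) μB) := fun k => S.Qm_prob (htt k).2 μB
  let ν : ℕ → ProbabilityMeasure Y := fun k => ⟨S.Qm (t k) μB, hprob k⟩
  have hνle : ∀ k, (ν k : Measure Y) ≤ c⁻¹ • μ := fun k => S.Qm_mono (htt k).2 μB μ _ hBle hμ.1
  have hcinv0 : c⁻¹ ≠ ∞ := ENNReal.inv_ne_top.2 hBpos.ne'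
  have hct : c ≠ ∞ := ne_top_of_le_ne_top ENNReal.one_ne_top hc1
  have htight : IsTightMeasureSet {((μ : ProbabilityMeasure Y) : Measure Y) | μ ∈ range ν} := by
    rw [isTightMeasureSet_iff_exists_isCompact_measure_compl_le]
    intro ε hε
    have := (isTightMeasureSet_iff_exists_isCompact_measure_compl_le.1
      (isTightMeasureSet_singleton (μ := μ))) (c * ε) (ENNReal.mul_pos hBpos.ne' hε.ne')
    obtain ⟨K, hK, hKle⟩ := this
    refine ⟨K, hK, ?_⟩
    rintro _ ⟨_, ⟨k, rfl⟩, rfl⟩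
    calc (ν k : Measure Y) Kᶜ ≤ (c⁻¹ • μ) Kᶜ := hνle k _
      _ = c⁻¹ * μ Kᶜ := rfl
      _ ≤ c⁻¹ * (c * ε) := by gcongr; exact hKle μ rfl
      _ = ε := by rw [← mul_assoc, ENNReal.inv_mul_cancel hBpos.ne' hct, one_mul]
  obtain ⟨ν0, -, φ, hφ, hlim⟩ := (isCompact_closure_of_isTightMeasureSet htight).isSeqCompact
    (fun n => subset_closure (mem_range_self n) : ∀ n, ν n ∈ closure (range ν))
  have hintg := ProbabilityMeasure.tendsto_iff_forall_integral_tendsto.1 hlim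
  have htφ : Tendsto (fun k => t (φ k)) atTop atTop := ht.comp hφ.tendsto_atTop
  -- invariance
  have hinv : S.Invariant (ν0 : Measure Y) := by
    rw [S.invariant_iff]
    intro s hs g
    have h1 := (hintg (S.Pb g s hs)).sub (hintg g)
    have h2 : Tendsto (fun k => 2 * ‖g‖ * s / t (φ k)) atTop (𝓝 0) :=
      tendsto_const_nhds.div_atTop htφ
    have h3 := squeeze_zero_norm (f := fun k => ∫ y, S.Pb g s hs y ∂(S.Qm (t (φ k)) μB)
      - ∫ y, g y ∂(S.Qm (t (φ k)) μB)) (fun k => S.asymp_inv g (htt (φ k)).2 hs μB) h2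
    have := tendsto_nhds_unique h1 h3
    exact sub_eq_zero.1 this
  -- domination
  have hdom : c • (ν0 : Measure Y) ≤ μ := by
    have : (ν0 : Measure Y) ≤ c⁻¹ • μ := by
      have hfin : IsFiniteMeasure (c⁻¹ • μ) := Measure.smul_finite μ hcinv0
      rw [Measure.le_iff]
      intro A hA
      rw [Set.measure_eq_iInf_isOpen A (c⁻¹ • μ)]
      refine le_iInf fun U => le_iInf fun hU => le_iInf fun hUo => ?_
      refine (measure_mono hU).trans ?_
      refine (ProbabilityMeasure.le_liminf_measure_open_of_tendsto hlim hUo).trans ?_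
      refine (liminf_le_liminf (v := fun _ => (c⁻¹ • μ) U)
        (Eventually.of_forall fun k => hνle (φ k) U)).trans ?_
      simp
    calc c • (ν0 : Measure Y) ≤ c • (c⁻¹ • μ) := by gcongr
      _ = μ := by rw [smul_smul, ENNReal.mul_inv_cancel hBpos.ne' hct, one_smul]
  have heq := S.ergodic_extreme μ ν0 hμ hinv c hBpos.ne' hc1 hdom
  -- lower bound
  have hfi := hintg f
  rw [heq] at hfi
  have hlow : Tendsto (fun k => ∫ x, min (S.Qf (t (φ k)) f x) (m + δ / 2) ∂μB) atTop
      (𝓝 (∫ x, (m + δ / 2) ∂μB)) := by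
    refine tendsto_integral_of_dominated_convergence (fun _ => max ‖f‖ |m + δ / 2|) ?_ ?_ ?_ ?_
    · intro k
      exact ((S.Qf_meas f (htt (φ k)).2).min measurable_const).aestronglyMeasurable
    · exact integrable_const _
    · intro k
      refine ae_of_all _ fun x => ?_
      rw [Real.norm_eq_abs]
      exact abs_min_le_max_abs_abs.trans (max_le_max (S.Qf_bound f (htt (φ k)).2 x) le_rfl)
    · have : ∀ᵐ x ∂μB, x ∈ B := by
        rw [hμB]; exact ae_cond_mem hBm
      filter_upwards [this] with x hx
      refine tendsto_const_nhds.congr' ?_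
      filter_upwards [htφ.eventually (hB x hx)] with k hk
      have h1 := (htt (φ k)).1
      have h2 := (abs_lt.1 hk).1
      rw [min_eq_right]
      simp only [not_lt] at h1
      linarith
  have hle : ∀ k, ∫ x, min (S.Qf (t (φ k)) f x) (m + δ / 2) ∂μB ≤ ∫ x, f x ∂(ν (φ k) : Measure Y) := by
    intro k
    change _ ≤ ∫ x, f x ∂(S.Qm (t (φ k)) μB)
    have hpos := (htt (φ k)).2
    rw [S.integral_Qm f hpos]
    have i1 : Integrable (fun x => S.Qf (t (φ k)) f x) μB :=
      Integrable.of_bound (S.Qf_meas f hpos).aestronglyMeasurable ‖f‖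
        (ae_of_all _ fun x => S.Qf_bound f hpos x)
    refine integral_mono (i1.inf (integrable_const _)) i1 fun x => min_le_left _ _
  have := le_of_tendsto_of_tendsto' hlow hfi hle
  simp at this
  linarith

theorem ergodic_conv [CompleteSpace Y] (S : MarkovFellerSemigroup Y)
    (h : ∀ z : Y, S.CesaroEvContAt z)
    (μ : Measure Y) (hμ : S.ErgodicInv μ) {y : Y} (hy : y ∈ μ.support) (f : Y →ᵇ ℝ)
    {L : NNReal} (hf : LipschitzWith L f) :
    Tendsto (fun t => S.Qf t f y) atTop (𝓝 (∫ x, f x ∂μ)) := by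
  have hneg : ∀ t, S.Qf t (-f : Y →ᵇ ℝ) y = - S.Qf t f y := by
    intro t
    simp [Qf, Pf, integral_neg]
  rw [Metric.tendsto_nhds]
  intro δ hδ
  filter_upwards [S.ergodic_upper h μ hμ hy f hf hδ,
    S.ergodic_upper h μ hμ hy (-f) hf.neg hδ] with t h1 h2
  rw [hneg] at h2
  have : ∫ x, (-f) x ∂μ = - ∫ x, f x ∂μ := by simp [integral_neg]
  rw [this] at h2
  rw [Real.dist_eq, abs_lt]
  constructor <;> linarith

end Helpers2

section Helpers3

open ProbabilityTheory BoundedContinuousFunction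

variable {Y : Type*} [MetricSpace Y] [SecondCountableTopology Y] [MeasurableSpace Y] [BorelSpace Y]

/-- real valued thickened indicator as a bounded continuous function -/
noncomputable def thk {δ : ℝ} (hδ : 0 < δ) (A : Set Y) : Y →ᵇ ℝ :=
  BoundedContinuousFunction.ofNormedAddCommGroup
    (fun y => (thickenedIndicator hδ A y : ℝ)) (by fun_prop) 1
    (fun y => by simpa using! thickenedIndicator_le_one hδ A y)

theorem thk_lip {δ : ℝ} (hδ : 0 < δ) (A : Set Y) : LipschitzWith δ.toNNReal⁻¹ (thk hδ A) :=
  lipschitzWith_thickenedIndicator hδ A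

theorem thk_nonneg {δ : ℝ} (hδ : 0 < δ) (A : Set Y) (y : Y) : 0 ≤ thk hδ A y := NNReal.coe_nonneg _

theorem thk_le_one {δ : ℝ} (hδ : 0 < δ) (A : Set Y) (y : Y) : thk hδ A y ≤ 1 :=
  thickenedIndicator_le_one hδ A y

theorem thk_one {δ : ℝ} (hδ : 0 < δ) (A : Set Y) {y : Y} (hy : y ∈ A) : thk hδ A y = 1 := by
  change ((thickenedIndicator hδ A y : NNReal) : ℝ) = 1
  rw [thickenedIndicator_one hδ A hy]; simp

theorem thk_zero {δ : ℝ} (hδ : 0 < δ) (A : Set Y) {y : Y} (hy : y ∉ thickening δ A) :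
    thk hδ A y = 0 := by
  change ((thickenedIndicator hδ A y : NNReal) : ℝ) = 0
  rw [thickenedIndicator_zero hδ A hy]; simp

theorem thk_mono {δ : ℝ} (hδ : 0 < δ) {A A' : Set Y} (hA : A ⊆ A') (y : Y) :
    thk hδ A y ≤ thk hδ A' y :=
  thickenedIndicator_subset hδ hA y

theorem thk_congr {δ : ℝ} (hδ : 0 < δ) {A A' : Set Y} {y : Y} (h : infEDist y A = infEDist y A') :
    thk hδ A y = thk hδ A' y := by
  change ((thickenedIndicator hδ A y : NNReal) : ℝ) = ((thickenedIndicator hδ A' y : NNReal) : ℝ)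
  rw [thickenedIndicator_apply, thickenedIndicator_apply]
  simp [thickenedIndicatorAux, h]

theorem eq_of_lip (μ ν : Measure Y) [IsProbabilityMeasure μ] [IsProbabilityMeasure ν]
    (h : ∀ (f : Y →ᵇ ℝ) (L : NNReal), LipschitzWith L f → ∫ x, f x ∂μ = ∫ x, f x ∂ν) : μ = ν := by
  refine ext_of_generate_finite _ ?_ isPiSystem_isClosed (fun F hF ↦ ?_) (by simp)
  · rw [BorelSpace.measurable_eq (α := Y), borel_eq_generateFrom_isClosed]
  have hδ : ∀ n : ℕ, (0:ℝ) < 1 / ((n:ℝ) + 1) := fun n => by positivity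
  have h1 := tendsto_integral_thickenedIndicator_of_isClosed μ hF hδ
        tendsto_one_div_add_atTop_nhds_zero_nat
  have h2 := tendsto_integral_thickenedIndicator_of_isClosed ν hF hδ
        tendsto_one_div_add_atTop_nhds_zero_nat
  have h3 : ∀ n, ∫ y, (thickenedIndicator (hδ n) F y : ℝ) ∂μ =
      ∫ y, (thickenedIndicator (hδ n) F y : ℝ) ∂ν := fun n => h (thk (hδ n) F) _ (thk_lip (hδ n) F)
  simp_rw [h3] at h1
  have := tendsto_nhds_unique h1 h2
  exact (measureReal_eq_measureReal_iff).1 this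

theorem ergodic_of_conv (S : MarkovFellerSemigroup Y) (μ : Measure Y) (hμ : S.Invariant μ)
    (hc : ∀ y ∈ μ.support, ∀ (f : Y →ᵇ ℝ) (L : NNReal), LipschitzWith L f →
      Tendsto (fun t => S.Qf t f y) atTop (𝓝 (∫ x, f x ∂μ))) : S.ErgodicInv μ := by
  have := hμ.1
  have key : ∀ μ₁ μ₂ : Measure Y, S.Invariant μ₁ → μ = (2 : ℝ≥0∞)⁻¹ • (μ₁ + μ₂) → μ₁ = μ := by
    intro μ₁ μ₂ h1 he
    have := h1.1
    have hac : μ₁ ≪ μ := by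
      intro A hA
      rw [he] at hA
      simpa using (by simpa using hA : μ₁ A = 0 ∧ μ₂ A = 0).1
    refine eq_of_lip _ _ fun f L hf => ?_
    have hae : ∀ᵐ y ∂μ₁, y ∈ μ.support := hac.ae_le Measure.support_mem_ae
    have hpos : ∀ k : ℕ, (0:ℝ) < (k:ℝ) + 1 := fun k => by positivity
    have hlim : Tendsto (fun k : ℕ => ∫ x, S.Qf ((k:ℝ) + 1) f x ∂μ₁) atTop
        (𝓝 (∫ y, (∫ x, f x ∂μ) ∂μ₁)) := by
      refine tendsto_integral_of_dominated_convergence (fun _ => ‖f‖) ?_ (integrable_const _) ?_ ?_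
      · exact fun k => (S.Qf_meas f (hpos k)).aestronglyMeasurable
      · exact fun k => ae_of_all _ fun x => S.Qf_bound f (hpos k) x
      · filter_upwards [hae] with y hy
        exact (hc y hy f L hf).comp
          (tendsto_atTop_add_const_right _ _ tendsto_natCast_atTop_atTop)
    simp_rw [S.integral_Qf_inv μ₁ h1 f (hpos _)] at hlim
    have := tendsto_nhds_unique tendsto_const_nhds hlim
    simpa using this
  refine ⟨hμ, fun μ₁ μ₂ h1 h2 he => ⟨key μ₁ μ₂ h1 he, key μ₂ μ₁ h2 ?_⟩⟩
  rw [he, add_comm]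

theorem isClosed_ergodic [CompleteSpace Y] (S : MarkovFellerSemigroup Y)
    (h : ∀ z : Y, S.CesaroEvContAt z) :
    IsClosed {μ : ProbabilityMeasure Y | S.ErgodicInv (μ : Measure Y)} := by
  refine isClosed_of_closure_subset fun μ hμ => ?_
  have hinv : S.Invariant (μ : Measure Y) :=
    closure_minimal (fun ν hν => hν.1) S.isClosed_invariant hμ
  refine S.ergodic_of_conv _ hinv fun y hy f L hf => ?_
  rw [Metric.tendsto_nhds]
  intro δ hδ
  have hδ3 : 0 < δ / 3 := by positivity
  obtain ⟨r, hr, hB⟩ := Metric.eventually_nhds_iff_ball.1 (S.evcont (h y) f hf hδ3)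
  have hr2 : 0 < r / 2 := half_pos hr
  let g : Y →ᵇ ℝ := thk hr2 (ball y (r / 2))
  have hgpos : 0 < ∫ x, g x ∂(μ : Measure Y) := by
    have h1 : 0 < (μ : Measure Y) (ball y (r / 2)) :=
      (Measure.mem_support_iff_forall y).1 hy _ (ball_mem_nhds y hr2)
    rw [integral_pos_iff_support_of_nonneg (fun x => thk_nonneg _ _ _) (g.integrable _)]
    refine h1.trans_le (measure_mono fun x hx => ?_)
    simp [g, thk_one hr2 _ hx]
  have hW : ∀ᶠ ν : ProbabilityMeasure Y in 𝓝 μ, 0 < ∫ x, g x ∂(ν : Measure Y) ∧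
      dist (∫ x, f x ∂(ν : Measure Y)) (∫ x, f x ∂(μ : Measure Y)) < δ / 3 := by
    have c1 := (ProbabilityMeasure.continuous_integral_boundedContinuousFunction g).tendsto μ
    have c2 := (ProbabilityMeasure.continuous_integral_boundedContinuousFunction f).tendsto μ
    exact (c1.eventually (lt_mem_nhds hgpos)).and (c2.eventually (ball_mem_nhds _ hδ3))
  obtain ⟨ν, hνE, hν1, hν2⟩ := ((mem_closure_iff_frequently.1 hμ).and_eventually hW).exists
  have hBpos : 0 < (ν : Measure Y) (ball y r) := by
    rw [integral_pos_iff_support_of_nonneg (fun x => thk_nonneg _ _ _) (g.integrable _)] at hν1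
    refine hν1.trans_le (measure_mono fun x hx => ?_)
    by_contra hxb
    refine hx (thk_zero hr2 _ fun hx2 => hxb ?_)
    rw [mem_thickening_iff] at hx2
    obtain ⟨z, hz, hxz⟩ := hx2
    rw [mem_ball] at hz ⊢
    linarith [dist_triangle x z y]
  obtain ⟨z, hzB, hzs⟩ := Measure.nonempty_inter_support_of_pos hBpos
  have hz := S.ergodic_conv h ν hνE hzs f hf
  filter_upwards [hB z hzB, (Metric.tendsto_nhds.1 hz) _ hδ3] with t h1 h2
  rw [Real.dist_eq] at *
  rw [abs_lt] at *
  constructor <;> linarith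

theorem supp_inter [CompleteSpace Y] (S : MarkovFellerSemigroup Y)
    (h : ∀ z : Y, S.CesaroEvContAt z) (K : Set Y) (hK : IsCompact K)
    (hlow : ∀ ε > (0:ℝ), ∀ x : Y,
      0 < limsup (fun t => S.Qmeas t x (Metric.thickening ε K)) atTop)
    (μ : Measure Y) (hμ : S.ErgodicInv μ) : ∃ x ∈ K, x ∈ μ.support := by
  have hp := hμ.1.1
  have key : ∀ ε > (0:ℝ), ∃ x ∈ μ.support, x ∈ thickening ε K := by
    intro ε hε
    by_contra! hcon
    have hε2 : 0 < ε / 2 := half_pos hε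
    obtain ⟨x, hx⟩ := Measure.nonempty_support (IsProbabilityMeasure.ne_zero μ)
    let g : Y →ᵇ ℝ := thk hε2 (thickening (ε / 2) K)
    have hconv := S.ergodic_conv h μ hμ hx g (thk_lip hε2 _)
    have hz : ∫ x, g x ∂μ = 0 := by
      refine integral_eq_zero_of_ae ?_
      filter_upwards [Measure.support_mem_ae (μ := μ)] with y hy
      refine thk_zero hε2 _ fun hy2 => hcon y hy ?_
      have := thickening_thickening_subset (ε / 2) (ε / 2) K hy2
      simpa using this
    rw [hz] at hconv
    have hpos := hlow (ε / 2) hε2 x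
    have hto : Tendsto (fun t => S.Qmeas t x (thickening (ε / 2) K)) atTop (𝓝 0) := by
      refine tendsto_of_tendsto_of_tendsto_of_le_of_le' tendsto_const_nhds hconv ?_ ?_
      · filter_upwards [eventually_gt_atTop 0] with t ht
        rw [Qmeas, ← integral_tau ht]
        exact integral_nonneg fun s => ENNReal.toReal_nonneg
      · filter_upwards [eventually_gt_atTop 0] with t ht
        have := tau_prob ht
        rw [Qmeas, ← integral_tau ht, S.Qf_eq g ht]
        refine integral_mono_of_nonneg (ae_of_all _ fun s => ENNReal.toReal_nonneg) ?_ ?_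
        · exact Integrable.of_bound ((S.measurable_pk_bcf g).comp
            (measurable_id.prodMk measurable_const)).aestronglyMeasurable ‖g‖
            (ae_of_all _ fun q => g.norm_integral_le_norm _)
        · filter_upwards [tau_ae t] with s hs
          have := S.isProb s hs.le x
          simp only [pk, max_eq_left hs.le]
          change (S.P s x).real (thickening (ε / 2) K) ≤ _
          rw [← integral_indicator_one isOpen_thickening.measurableSet]
          refine integral_mono_of_nonneg (ae_of_all _ fun y => indicator_nonneg (by simp) _)
            (g.integrable _) (ae_of_all _ fun y => ?_)
          by_cases hy : y ∈ thickening (ε / 2) K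
          · simp [g, hy, thk_one hε2 _ hy]
          · simp only [indicator_of_notMem hy]
            exact thk_nonneg _ _ _
    rw [hto.limsup_eq] at hpos
    exact lt_irrefl _ hpos
  have hn : ∀ n : ℕ, ∃ k ∈ K, ∃ x ∈ μ.support, dist x k < 1 / ((n:ℝ) + 1) := by
    intro n
    obtain ⟨x, hx, hxK⟩ := key (1 / ((n:ℝ) + 1)) (by positivity)
    obtain ⟨k, hk, hd⟩ := mem_thickening_iff.1 hxK
    exact ⟨k, hk, x, hx, hd⟩
  choose k hk x hx hd using hn
  obtain ⟨a, ha, φ, hφ, hlim⟩ := hK.isSeqCompact hk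
  refine ⟨a, ha, ?_⟩
  have hx' : Tendsto (fun n => x (φ n)) atTop (𝓝 a) := by
    refine tendsto_of_tendsto_of_dist hlim ?_
    refine squeeze_zero (fun _ => dist_nonneg) (fun n => ?_)
      (tendsto_one_div_add_atTop_nhds_zero_nat.comp hφ.tendsto_atTop)
    rw [Function.comp_apply, dist_comm]
    exact (hd (φ n)).le
  exact Measure.isClosed_support.mem_of_tendsto hx' (Eventually.of_forall fun n => hx _)

end Helpers3

section Helpers4

open ProbabilityTheory BoundedContinuousFunction

/-- A gliding hump statement proved through Baire category on the Cantor space. -/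
theorem gliding_hump (F : ℕ → (ℕ → Bool) → ℝ) (hcont : ∀ n, Continuous (F n))
    (hconv : ∀ I, CauchySeq fun n => F n I) {ε : ℝ} (hε : 0 < ε)
    (hjump : ∀ n I, ε ≤ F n (Function.update I n true) - F n (Function.update I n false)) :
    False := by
  have hδ : 0 < ε / 4 := by positivity
  let A : ℕ → Set (ℕ → Bool) := fun N => ⋂ n ≥ N, {I | dist (F n I) (F N I) ≤ ε / 4}
  have hAc : ∀ N, IsClosed (A N) := fun N =>
    isClosed_iInter fun n => isClosed_iInter fun _ =>
      isClosed_le ((hcont n).dist (hcont N)) continuous_const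
  have hAu : ⋃ N, A N = univ := by
    refine eq_univ_of_forall fun I => mem_iUnion.2 ?_
    obtain ⟨N, hN⟩ := Metric.cauchySeq_iff'.1 (hconv I) (ε / 4) hδ
    exact ⟨N, mem_iInter₂.2 fun n hn => (hN n hn).le⟩
  obtain ⟨N, I, hI⟩ := nonempty_interior_of_iUnion_of_closed hAc hAu
  have hupd : ∀ b : Bool, Tendsto (fun k => Function.update I k b) atTop (𝓝 I) := by
    intro b
    rw [tendsto_pi_nhds]
    intro j
    refine tendsto_const_nhds.congr' ?_
    filter_upwards [eventually_gt_atTop j] with k hk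
    rw [Function.update_of_ne hk.ne]
  have hintg : A N ∈ 𝓝 I := mem_interior_iff_mem_nhds.1 hI
  have hFN : Tendsto (fun k => F N (Function.update I k true) - F N (Function.update I k false))
      atTop (𝓝 (F N I - F N I)) :=
    (((hcont N).tendsto I).comp (hupd true)).sub (((hcont N).tendsto I).comp (hupd false))
  rw [sub_self] at hFN
  obtain ⟨k, h1, h2, h3, h4⟩ := (((hupd true).eventually hintg).and
    (((hupd false).eventually hintg).and ((eventually_ge_atTop N).and
      (hFN.eventually (gt_mem_nhds hδ))))).exists
  have d1 := mem_iInter₂.1 h1 k h3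
  have d2 := mem_iInter₂.1 h2 k h3
  simp only [mem_ofPred_eq, Real.dist_eq] at d1 d2
  have d1' := abs_le.1 d1
  have d2' := abs_le.1 d2
  have := hjump k I
  linarith [d1'.2, d2'.1]

variable {Y : Type*} [MetricSpace Y] [SecondCountableTopology Y] [MeasurableSpace Y] [BorelSpace Y]

theorem infEDist_sep {r : ℝ} {A : ℕ → Set Y} (hsep : ∀ n m, n ≠ m → ∀ a ∈ A n, ∀ b ∈ A m,
    r ≤ dist a b) {n m : ℕ} (hnm : n ≠ m) {y : Y}
    (hy : y ∈ thickening (r / 2) (A n)) : y ∉ thickening (r / 2) (A m) := by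
  intro hy2
  obtain ⟨a, ha, hya⟩ := mem_thickening_iff.1 hy
  obtain ⟨b, hb, hyb⟩ := mem_thickening_iff.1 hy2
  have := hsep n m hnm a ha b hb
  linarith [dist_triangle_left a b y]

/-- Weakly Cauchy sequences do not have separated humps. -/
theorem no_humps (μ : ℕ → ProbabilityMeasure Y)
    (hc : ∀ (f : Y →ᵇ ℝ) (L : NNReal), LipschitzWith L f →
      CauchySeq fun n => ∫ x, f x ∂(μ n : Measure Y))
    (A : ℕ → Set Y) (hA : ∀ n, MeasurableSet (A n)) {r ε : ℝ} (hr : 0 < r) (hε : 0 < ε)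
    (hsep : ∀ n m, n ≠ m → ∀ a ∈ A n, ∀ b ∈ A m, r ≤ dist a b)
    (hm : ∀ n, ε ≤ (μ n : Measure Y).real (A n)) : False := by
  have hr2 : 0 < r / 2 := half_pos hr
  let U : (ℕ → Bool) → Set Y := fun I => ⋃ n, ⋃ (_ : I n = true), A n
  let f : (ℕ → Bool) → Y →ᵇ ℝ := fun I => thk hr2 (U I)
  have hUthick : ∀ I y, y ∈ thickening (r / 2) (U I) →
      ∃ n, I n = true ∧ y ∈ thickening (r / 2) (A n) := by
    intro I y hy
    obtain ⟨z, hz, hd⟩ := mem_thickening_iff.1 hy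
    obtain ⟨n, hn, hzn⟩ := mem_iUnion₂.1 hz
    exact ⟨n, hn, mem_thickening_iff.2 ⟨z, hzn, hd⟩⟩
  refine gliding_hump (fun n I => ∫ x, f I x ∂(μ n : Measure Y)) ?_
    (fun I => hc (f I) _ (thk_lip hr2 _)) hε ?_
  · intro n
    refine continuous_of_dominated (bound := fun _ => 1)
      (fun I => (f I).continuous.aestronglyMeasurable)
      (fun I => ae_of_all _ fun y => ?_) (integrable_const _) (ae_of_all _ fun y => ?_)
    · rw [Real.norm_eq_abs, abs_of_nonneg (thk_nonneg _ _ _)]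
      exact thk_le_one _ _ _
    · by_cases hy : ∃ n, y ∈ thickening (r / 2) (A n)
      · obtain ⟨k, hk⟩ := hy
        have : (fun I => f I y) = fun I : ℕ → Bool => if I k = true then thk hr2 (A k) y else 0 := by
          funext I
          by_cases hIk : I k = true
          · rw [if_pos hIk]
            refine thk_congr hr2 (le_antisymm ?_ ?_)
            · exact infEDist_anti (subset_iUnion₂_of_subset k hIk le_rfl)
            · simp only [U, infEDist_iUnion]
              refine le_iInf fun j => le_iInf fun hj => ?_
              by_cases hjk : k = j
              · rw [hjk]
              · have h1 := infEDist_sep hsep hjk hk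
                rw [mem_thickening_iff_infEDist_lt, not_lt] at h1
                rw [mem_thickening_iff_infEDist_lt] at hk
                exact hk.le.trans h1
          · rw [if_neg hIk]
            refine thk_zero hr2 _ fun hy => ?_
            obtain ⟨j, hj, hyj⟩ := hUthick I y hy
            have hjk : k ≠ j := fun hkj => hIk (hkj ▸ hj)
            exact infEDist_sep hsep hjk hk hyj
        rw [this]
        have : Continuous fun b : Bool => if b = true then thk hr2 (A k) y else 0 :=
          continuous_of_discreteTopology
        exact this.comp (continuous_apply k)
      · have : (fun I => f I y) = fun _ => 0 := by
          funext I
          refine thk_zero hr2 _ fun hyI => hy ?_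
          obtain ⟨j, -, hj⟩ := hUthick I y hyI
          exact ⟨j, hj⟩
        rw [this]
        exact continuous_const
  · intro n I
    refine (hm n).trans ?_
    change _ ≤ ∫ x, f (Function.update I n true) x ∂(μ n : Measure Y)
      - ∫ x, f (Function.update I n false) x ∂(μ n : Measure Y)
    rw [← integral_sub ((f _).integrable _) ((f _).integrable _),
      ← integral_indicator_one (hA n)]
    refine integral_mono_of_nonneg (ae_of_all _ fun y => indicator_nonneg (by simp) _)
      (((f _).integrable _).sub ((f _).integrable _)) (ae_of_all _ fun y => ?_)
    by_cases hy : y ∈ A n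
    · have h1 : f (Function.update I n true) y = 1 :=
        thk_one hr2 _ (mem_iUnion₂.2 ⟨n, by simp, hy⟩)
      have h0 : f (Function.update I n false) y = 0 := by
        refine thk_zero hr2 _ fun hyI => ?_
        obtain ⟨j, hj, hyj⟩ := hUthick _ y hyI
        have hjn : n ≠ j := by
          rintro rfl
          simp at hj
        exact infEDist_sep hsep hjn (self_subset_thickening hr2 _ hy) hyj
      simp [hy, h1, h0]
    · simp only [indicator_of_notMem hy]
      refine sub_nonneg.2 (thk_mono hr2 ?_ y)
      intro z hz
      obtain ⟨j, hj, hzj⟩ := mem_iUnion₂.1 hz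
      refine mem_iUnion₂.2 ⟨j, ?_, hzj⟩
      by_cases hjn : j = n
      · subst hjn; simp
      · rwa [Function.update_of_ne hjn] at hj ⊢

/-- Tightness from uniform approximate total boundedness. -/
theorem tight_of_cover [CompleteSpace Y] (E : Set (ProbabilityMeasure Y))
    (h : ∀ (ε : ℝ≥0∞), 0 < ε → ∀ r > (0:ℝ), ∃ F : Set Y, F.Finite ∧ ∀ μ ∈ E,
      (μ : Measure Y) (thickening r F)ᶜ ≤ ε) :
    IsTightMeasureSet {((μ : ProbabilityMeasure Y) : Measure Y) | μ ∈ E} := by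
  rw [isTightMeasureSet_iff_exists_isCompact_measure_compl_le]
  intro ε hε
  obtain ⟨u, hu0, hus⟩ := ENNReal.exists_pos_sum_of_countable' hε.ne' ℕ
  choose F hF hFE using fun n : ℕ => h (u n) (hu0 n) (1 / ((n:ℝ) + 1)) (by positivity)
  let K : Set Y := ⋂ n : ℕ, cthickening (1 / ((n:ℝ) + 1)) (F n)
  refine ⟨K, ?_, ?_⟩
  · refine isCompact_iff_totallyBounded_isComplete.2 ⟨?_,
      (isClosed_iInter fun n => isClosed_cthickening).isComplete⟩
    rw [Metric.totallyBounded_iff]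
    intro δ hδ
    obtain ⟨n, hn⟩ := exists_nat_one_div_lt hδ
    refine ⟨F n, hF n, fun y hy => ?_⟩
    have := cthickening_subset_thickening' hδ hn (F n) (mem_iInter.1 hy n)
    rw [thickening_eq_biUnion_ball] at this
    exact this
  · rintro _ ⟨μ, hμ, rfl⟩
    calc (μ : Measure Y) Kᶜ ≤ (μ : Measure Y) (⋃ n : ℕ, (thickening (1 / ((n:ℝ) + 1)) (F n))ᶜ) := by
          refine measure_mono ?_
          rw [compl_iInter]
          exact iUnion_mono fun n => compl_subset_compl.2 (thickening_subset_cthickening _ _)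
      _ ≤ ∑' n : ℕ, (μ : Measure Y) (thickening (1 / ((n:ℝ) + 1)) (F n))ᶜ := measure_iUnion_le _
      _ ≤ ∑' n, u n := ENNReal.tsum_le_tsum fun n => hFE n μ hμ
      _ ≤ ε := hus.le

/-- If a family is not uniformly approximately totally bounded, humps exist. -/
theorem exists_humps (E : Set (ProbabilityMeasure Y)) (ε : ℝ≥0∞) {r : ℝ} (hr : 0 < r)
    (h : ∀ F : Set Y, F.Finite → ∃ μ ∈ E, ε < (μ : Measure Y) (thickening r F)ᶜ) :
    ∃ (μ : ℕ → ProbabilityMeasure Y) (A : ℕ → Set Y), (∀ n, μ n ∈ E) ∧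
      (∀ n, MeasurableSet (A n)) ∧ (∀ n, ε < (μ n : Measure Y) (A n)) ∧
      (∀ n m, n ≠ m → ∀ a ∈ A n, ∀ b ∈ A m, r / 2 ≤ dist a b) := by
  have hr2 : 0 < r / 2 := half_pos hr
  have step : ∀ F : Finset Y, ∃ μ ∈ E, ∃ G : Finset Y,
      ε < (μ : Measure Y) ((thickening r (F : Set Y))ᶜ ∩ thickening (r / 2) (G : Set Y)) := by
    intro F
    obtain ⟨μ, hμ, hlt⟩ := h F F.finite_toSet
    refine ⟨μ, hμ, ?_⟩
    have hne : Nonempty Y := by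
      by_contra hne
      rw [not_nonempty_iff] at hne
      rw [Set.eq_empty_of_isEmpty (thickening r (F : Set Y))ᶜ] at hlt
      simp at hlt
    classical
    let D := TopologicalSpace.denseSeq Y
    let G : ℕ → Finset Y := fun n => (Finset.range n).image D
    have hmono : Monotone fun n => (thickening r (F : Set Y))ᶜ ∩ thickening (r / 2) (G n : Set Y) := by
      intro a b hab
      refine inter_subset_inter_right _ (thickening_subset_of_subset _ ?_)
      exact_mod_cast Finset.image_subset_image (Finset.range_mono hab)
    have hun : ⋃ n, (thickening r (F : Set Y))ᶜ ∩ thickening (r / 2) (G n : Set Y)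
        = (thickening r (F : Set Y))ᶜ := by
      rw [← inter_iUnion]
      refine inter_eq_left.2 fun y _ => ?_
      obtain ⟨n, hn⟩ := (TopologicalSpace.denseRange_denseSeq Y).exists_dist_lt y hr2
      refine mem_iUnion.2 ⟨n + 1, mem_thickening_iff.2 ⟨D n, ?_, hn⟩⟩
      exact_mod_cast Finset.mem_image_of_mem D (Finset.self_mem_range_succ n)
    have ht := tendsto_measure_iUnion_atTop (μ := (μ : Measure Y)) hmono
    rw [hun] at ht
    obtain ⟨n, hn⟩ := (ht.eventually (lt_mem_nhds hlt)).exists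
    exact ⟨G n, hn⟩
  choose M hM G hG using step
  classical
  obtain ⟨Fs, hFs⟩ : ∃ Fs : ℕ → Finset Y, ∀ n, Fs (n + 1) = Fs n ∪ G (Fs n) :=
    ⟨fun n => Nat.rec ∅ (fun _ F => F ∪ G F) n, fun n => rfl⟩
  have hFmono : Monotone Fs := monotone_nat_of_le_succ fun n => by
    rw [hFs]; exact Finset.subset_union_left
  let A : ℕ → Set Y := fun n =>
    (thickening r (↑(Fs n) : Set Y))ᶜ ∩ thickening (r / 2) (↑(G (Fs n)) : Set Y)
  have hsep : ∀ n m, n < m → ∀ a ∈ A n, ∀ b ∈ A m, r / 2 ≤ dist a b := by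
    intro n m hnm a ha b hb
    obtain ⟨g, hg, hag⟩ := mem_thickening_iff.1 ha.2
    have hgm : g ∈ Fs m := by
      refine hFmono (Nat.succ_le_of_lt hnm) ?_
      rw [Nat.succ_eq_add_one, hFs]
      exact Finset.mem_union_right _ hg
    have hbg : r ≤ dist b g := by
      by_contra hlt
      exact hb.1 (mem_thickening_iff.2 ⟨g, hgm, not_le.1 hlt⟩)
    linarith [dist_triangle_left b g a]
  refine ⟨fun n => M (Fs n), A, fun n => hM _, fun n => ?_, fun n => hG _, ?_⟩
  · exact isOpen_thickening.measurableSet.compl.inter isOpen_thickening.measurableSet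
  · intro n m hnm a ha b hb
    rcases lt_or_gt_of_ne hnm with h1 | h1
    · exact hsep n m h1 a ha b hb
    · rw [dist_comm]; exact hsep m n h1 b hb a ha

theorem ergodic_tight [CompleteSpace Y] (S : MarkovFellerSemigroup Y)
    (h : ∀ z : Y, S.CesaroEvContAt z) (K : Set Y) (hK : IsCompact K)
    (hlow : ∀ ε > (0:ℝ), ∀ x : Y,
      0 < limsup (fun t => S.Qmeas t x (Metric.thickening ε K)) atTop) :
    IsTightMeasureSet {((μ : ProbabilityMeasure Y) : Measure Y) |
      μ ∈ {μ : ProbabilityMeasure Y | S.ErgodicInv (μ : Measure Y)}} := by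
  refine tight_of_cover _ ?_
  by_contra! hcon
  obtain ⟨ε, hε, r, hr, hF⟩ := hcon
  obtain ⟨μ, A, hμ, hAm, hA, hsep⟩ := exists_humps _ ε hr hF
  choose x hxK hxs using fun n => S.supp_inter h K hK hlow (μ n) (hμ n)
  obtain ⟨a, -, φ, hφ, hlim⟩ := hK.isSeqCompact hxK
  have hεt : ε ≠ ∞ := (lt_of_lt_of_le (hA 0) le_top).ne
  refine no_humps (fun n => μ (φ n)) ?_ (fun n => A (φ n)) (fun n => hAm _) (half_pos hr)
    (ENNReal.toReal_pos hε.ne' hεt) (fun n m hnm => hsep _ _ (hφ.injective.ne hnm)) ?_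
  · intro f L hf
    rw [Metric.cauchySeq_iff']
    intro δ hδ
    have hδ4 : 0 < δ / 4 := by positivity
    have hev := hlim.eventually (S.evcont (h a) f hf hδ4)
    have hcl : ∀ n, ∀ᶠ t in atTop,
        dist (S.Qf t f (x (φ n))) (∫ y, f y ∂(μ (φ n) : Measure Y)) < δ / 4 := fun n =>
      (Metric.tendsto_nhds.1 (S.ergodic_conv h _ (hμ (φ n)) (hxs (φ n)) f hf)) _ hδ4
    obtain ⟨N, hN⟩ := eventually_atTop.1 hev
    refine ⟨N, fun n hn => ?_⟩
    obtain ⟨t, h1, h2, h3, h4⟩ := ((hN n hn).and ((hN N le_rfl).and ((hcl n).and (hcl N)))).exists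
    simp only [Function.comp_apply] at h1 h2
    rw [Real.dist_eq] at *
    rw [abs_lt] at *
    constructor <;> linarith
  · intro n
    exact ENNReal.toReal_mono (measure_ne_top _ _) (hA (φ n)).le

end Helpers4

variable {X : Type*} [MetricSpace X] [CompleteSpace X]
  [TopologicalSpace.SeparableSpace X] [MeasurableSpace X] [BorelSpace X]

theorem isCompact_ergodic_measures (S : MarkovFellerSemigroup X)
    (h : ∀ z : X, S.CesaroEvContAt z) (K : Set X) (hK : IsCompact K)
    (hlow : ∀ ε > (0:ℝ), ∀ x : X,
      0 < limsup (fun t => S.Qmeas t x (Metric.thickening ε K)) atTop) :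
    IsCompact {μ : ProbabilityMeasure X | S.ErgodicInv (μ : Measure X)} := by
  have : SecondCountableTopology X := UniformSpace.secondCountable_of_separable X
  have hc := isCompact_closure_of_isTightMeasureSet (S.ergodic_tight h K hK hlow)
  rwa [(S.isClosed_ergodic h).closure_eq] at hc

end MarkovFellerSemigroup
end
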